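/- arXiv:1804.07054 — 3 statements merged into one kernel-verified Lean document; each statement's English description precedes it below -/
import Mathlib

section
/- Let m, n, k be non-negative integers with 1 ≤ k ≤ n, and let 1 ≤ b_1 < b_2 < … < b_k ≤ m+k be integers. Then Σ_A Q^{q(A)}, the sum over all (m,n,k)-Gog trapezoids A with bottom row (b_1,…,b_k), where q(A) is the number of maxima of A not located in the bottom row (i.e. maxima a_{i,k} with i < n), equals the constant term in x_1,…,x_n of the Laurent polynomial ∏_{i=1}^{k} (1+x_i)^{b_i} x_i^{−n+1} · ∏_{i=k+1}^{n} (1+Q x_i)(1+x_i)^{m+k} x_i^{−n+i−k} · ∏_{1≤i<j≤n} (x_i − x_j)(1 + x_j + x_i x_j). -/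
open scoped BigOperators Classical

/-- The position `(i,j)` (row `i`, `j`-th entry of the row, both 1-based) belongs to the shape
of an `(m,n,k)`-Gog trapezoid. -/
def GogPos (n k i j : ℕ) : Prop := 1 ≤ i ∧ i ≤ n ∧ 1 ≤ j ∧ j ≤ i ∧ j ≤ k

/-- An `(m,n,k)`-Gog trapezoid, encoded as `a : ℕ → ℕ → ℤ` (zero off the shape): positive
entries, weak increase along NE- and SE-diagonals, strict increase along rows, and the entries
of the `i`-th SE-diagonal bounded above by `m+i`, i.e. `a i j ≤ m + n − i + j`. -/
def IsGog (m n k : ℕ) (a : ℕ → ℕ → ℤ) : Prop :=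
  (∀ i j, GogPos n k i j → 1 ≤ a i j ∧ a i j ≤ ((m + (n - i) + j : ℕ) : ℤ)) ∧
  (∀ i j, GogPos n k i j → GogPos n k (i+1) j → a (i+1) j ≤ a i j) ∧
  (∀ i j, GogPos n k i j → GogPos n k (i+1) (j+1) → a i j ≤ a (i+1) (j+1)) ∧
  (∀ i j, GogPos n k i j → GogPos n k i (j+1) → a i j < a i (j+1)) ∧
  (∀ i j, ¬ GogPos n k i j → a i j = 0)

/-- The number of maxima (entries `a_{i,k} = m+n−i+k` of the `k`-th NE-diagonal) with `i < n`,
i.e. not located in the bottom row. -/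
noncomputable def gogMaxAbove (m n k : ℕ) (a : ℕ → ℕ → ℤ) : ℕ :=
  ((Finset.Icc 1 n).filter
    (fun i => GogPos n k i k ∧ i < n ∧ a i k = ((m + (n - i) + k : ℕ) : ℤ))).card

/-- The exponent vector with `x_i`-entry `n−1` for `1 ≤ i ≤ k` and `n+k−i` for `k < i ≤ n`. -/
noncomputable def gogDeg (n k : ℕ) : ℕ →₀ ℕ :=
  (∑ i ∈ Finset.Icc 1 k, Finsupp.single i (n-1)) +
    ∑ i ∈ Finset.Icc (k+1) n, Finsupp.single i (n + k - i)

/-- The increasing map `ℕ → ℕ` whose range is the complement of `{i}`. -/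
def skipAt (i l : ℕ) : ℕ := if l < i then l else l + 1

lemma skipAt_injective (i : ℕ) : Function.Injective (skipAt i) := by
  intro a b h
  unfold skipAt at h
  split_ifs at h <;> omega

lemma skipAt_ne (i l : ℕ) : skipAt i l ≠ i := by
  unfold skipAt
  split_ifs <;> omega

lemma val_succAbove {n : ℕ} (i : Fin (n + 1)) (l : Fin n) :
    ((i.succAbove l : Fin (n + 1)) : ℕ) = skipAt i l := by
  unfold skipAt Fin.succAbove
  simp only [Fin.lt_def, Fin.val_castSucc]
  split_ifs <;> simp

section Products

variable {M : Type*} [CommMonoid M]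

/-- The product of `h i j` over all pairs `i < j < n`. -/
def pairProd (n : ℕ) (h : ℕ → ℕ → M) : M := ∏ j ∈ Finset.range n, ∏ i ∈ Finset.range j, h i j

lemma prod_range_succ_eq_mul_skipAt (f : ℕ → M) {i n : ℕ} (hi : i ≤ n) :
    ∏ l ∈ Finset.range (n + 1), f l = f i * ∏ l ∈ Finset.range n, f (skipAt i l) := by
  have := Fin.prod_univ_succAbove (fun l : Fin (n + 1) => f l) ⟨i, by omega⟩
  simpa only [val_succAbove, Fin.prod_univ_eq_prod_range f,
    Fin.prod_univ_eq_prod_range (fun l => f (skipAt i l))] using this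

lemma pairProd_succ_eq_mul_skipAt (h : ℕ → ℕ → M) {i n : ℕ} (hi : i ≤ n) :
    pairProd (n + 1) h = pairProd n (fun a b => h (skipAt i a) (skipAt i b)) *
      ∏ l ∈ Finset.range n, if l < i then h l i else h i (l + 1) := by
  induction n with
  | zero => simp [pairProd]
  | succ n ih =>
    rw [pairProd, Finset.prod_range_succ, ← pairProd]
    rcases Nat.lt_or_ge n i with hlt | hle
    · obtain rfl : i = n + 1 := by omega
      have hs : ∀ l < n + 1, skipAt (n + 1) l = l := fun l hl => by simp [skipAt, hl]
      congr 1
      · refine Finset.prod_congr rfl fun b hb => Finset.prod_congr rfl fun a ha => ?_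
        simp only [Finset.mem_range] at ha hb
        beta_reduce
        rw [hs a (by omega), hs b hb]
      · refine Finset.prod_congr rfl fun l hl => ?_
        rw [if_pos (by simpa using hl)]
    · rw [ih hle, prod_range_succ_eq_mul_skipAt (fun a => h a (n + 1)) hle]
      rw [Finset.prod_range_succ _ n, if_neg (by omega)]
      conv_rhs => rw [pairProd, Finset.prod_range_succ, ← pairProd]
      have : skipAt i n = n + 1 := by simp [skipAt, hle]
      rw [this]
      ac_rfl

lemma pairProd_mul (n : ℕ) (f g : ℕ → ℕ → M) :
    pairProd n (fun i j => f i j * g i j) = pairProd n f * pairProd n g := by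
  simp [pairProd, Finset.prod_mul_distrib]

lemma pairProd_eq_prod_filter (n : ℕ) (h : ℕ → ℕ → M) :
    pairProd n h =
      ∏ p ∈ (Finset.range n ×ˢ Finset.range n).filter (fun p => p.1 < p.2), h p.1 p.2 := by
  rw [Finset.prod_filter, Finset.prod_product_right]
  refine Finset.prod_congr rfl fun j hj => ?_
  rw [← Finset.prod_filter]
  refine Finset.prod_congr ?_ fun _ _ => rfl
  ext i
  simp only [Finset.mem_range, Finset.mem_filter] at *
  omega

end Products

/-- Expansion of the Vandermonde product along the highest power. -/
lemma pairProd_sub_succ {R : Type*} [CommRing R] (v : ℕ → R) (n : ℕ) :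
    pairProd (n + 1) (fun i j => v i - v j) =
      ∑ i ∈ Finset.range (n + 1), (-1) ^ i * v i ^ n *
        pairProd n (fun a b => v (skipAt i a) - v (skipAt i b)) := by
  have key : ∀ (N : ℕ) (w : ℕ → R), (Matrix.vandermonde fun i : Fin N => w i).det =
      (∏ j ∈ Finset.range N, (-1) ^ j) * pairProd N (fun i j => w i - w j) := by
    intro N w
    rw [Matrix.det_vandermonde, pairProd, ← Finset.prod_mul_distrib,
      ← Fin.prod_univ_eq_prod_range (fun j => (-1) ^ j * ∏ i ∈ Finset.range j, (w i - w j))]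
    rw [Finset.prod_sigma', Finset.prod_congr rfl
      (g := fun j : Fin N => ∏ i ∈ Finset.Iio j, (w j - w i))]
    · rw [Finset.prod_sigma']
      refine Finset.prod_bij' (fun p _ => ⟨p.2, p.1⟩) (fun p _ => ⟨p.2, p.1⟩)
        ?_ ?_ ?_ ?_ ?_ <;> simp
    · intro j _
      have : ∏ i ∈ Finset.range (j : ℕ), (w i - w j) = ∏ i ∈ Finset.Iio j, (w i - w j) := by
        refine (Finset.prod_bij (fun (i : Fin N) _ => (i : ℕ)) ?_ ?_ ?_ ?_).symm
        · intro i hi; simpa using hi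
        · intro a _ b _ hab; exact Fin.ext hab
        · intro i hi
          simp only [Finset.mem_range] at hi
          exact ⟨⟨i, by omega⟩, by simpa [Fin.lt_def] using hi, rfl⟩
        · intros; rfl
      rw [this]
      have hc : (j : ℕ) = (Finset.Iio j).card := by simp
      conv_lhs => rw [hc]
      rw [← Finset.prod_const, ← Finset.prod_mul_distrib]
      simp
  have hu : IsUnit (∏ j ∈ Finset.range (n + 1), (-1 : R) ^ j) := by
    rw [Finset.prod_pow_eq_pow_sum]
    exact (isUnit_one.neg).pow _
  apply hu.mul_left_cancel
  rw [← key, Matrix.det_succ_column _ (Fin.last n), Finset.mul_sum,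
    ← Fin.sum_univ_eq_sum_range (fun i => (∏ j ∈ Finset.range (n + 1), (-1 : R) ^ j) *
      ((-1) ^ i * v i ^ n * pairProd n (fun a b => v (skipAt i a) - v (skipAt i b))))]
  refine Finset.sum_congr rfl fun i _ => ?_
  have : (Matrix.vandermonde fun i : Fin (n + 1) => v i).submatrix i.succAbove
      (Fin.last n).succAbove = Matrix.vandermonde fun l : Fin n => v (skipAt i l) := by
    ext a b
    simp [Matrix.vandermonde_apply, val_succAbove]
  rw [this, key n (fun l => v (skipAt i l)), Finset.prod_range_succ]
  simp [Matrix.vandermonde_apply]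
  ring

section ConstantTerm

open MvPolynomial

variable {A : Type*} [CommRing A]

/-- The substitution `X_i ↦ 0` followed by relabelling the remaining variables in order, so that
`X (skipAt i l) ↦ X l`. -/
noncomputable def dropVar (i : ℕ) : MvPolynomial ℕ A →ₐ[A] MvPolynomial ℕ A :=
  aeval fun l => if l < i then X l else if l = i then 0 else X (l - 1)

lemma dropVar_X_self (i : ℕ) : dropVar i (X i : MvPolynomial ℕ A) = 0 := by
  simp [dropVar]

lemma dropVar_X_skipAt (i l : ℕ) : dropVar i (X (skipAt i l) : MvPolynomial ℕ A) = X l := by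
  rw [dropVar, aeval_X]
  unfold skipAt
  split_ifs with h1 h2 h3 <;> first | rfl | omega

/-- A coefficient not involving `X i` can be read off after setting `X i` to zero. -/
lemma coeff_mapDomain_skipAt (i : ℕ) (s : ℕ →₀ ℕ) (P : MvPolynomial ℕ A) :
    coeff (s.mapDomain (skipAt i)) P = coeff s (dropVar i P) := by
  have hdvd : (X i : MvPolynomial ℕ A) ∣ P - rename (skipAt i) (dropVar i P) := by
    rw [← Ideal.mem_span_singleton, ← Ideal.Quotient.eq]
    have : (Ideal.Quotient.mkₐ A (Ideal.span {(X i : MvPolynomial ℕ A)})) =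
        (Ideal.Quotient.mkₐ A (Ideal.span {(X i : MvPolynomial ℕ A)})).comp
          ((rename (skipAt i)).comp (dropVar i)) := by
      refine MvPolynomial.algHom_ext fun l => ?_
      rcases eq_or_ne l i with rfl | hl
      · simp only [AlgHom.comp_apply, dropVar_X_self, map_zero]
        rw [Ideal.Quotient.mkₐ_eq_mk, Ideal.Quotient.eq_zero_iff_mem]
        exact Ideal.mem_span_singleton_self _
      · obtain ⟨l', rfl⟩ : ∃ l', skipAt i l' = l := by
          rcases Nat.lt_or_ge l i with h | h
          · exact ⟨l, by simp [skipAt, h]⟩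
          · exact ⟨l - 1, by unfold skipAt; split_ifs <;> omega⟩
        simp only [AlgHom.comp_apply, dropVar_X_skipAt, rename_X]
    exact DFunLike.congr_fun this P
  obtain ⟨T, hT⟩ := hdvd
  rw [← coeff_rename_mapDomain (skipAt i) (skipAt_injective i) (dropVar i P), ← sub_eq_zero,
    ← coeff_sub, hT, coeff_X_mul', if_neg]
  rw [Finsupp.notMem_support_iff]
  exact Finsupp.mapDomain_of_notMem_range _ _ fun ⟨l, hl⟩ => skipAt_ne i l hl

/-- The exponent vector `(d, …, d)` in the first `n` variables. -/
noncomputable def constExp (n d : ℕ) : ℕ →₀ ℕ := ∑ i ∈ Finset.range n, Finsupp.single i d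

lemma constExp_apply (n d i : ℕ) : constExp n d i = if i < n then d else 0 := by
  simp [constExp, Finsupp.finsetSum_apply, Finsupp.single_apply]

lemma constExp_succ_left {n i : ℕ} (hi : i ≤ n) (d : ℕ) :
    constExp (n + 1) d = Finsupp.single i d + (constExp n d).mapDomain (skipAt i) := by
  ext l
  rcases eq_or_ne l i with rfl | hl
  · rw [Finsupp.add_apply, Finsupp.mapDomain_of_notMem_range _ _ fun ⟨l, hl⟩ => skipAt_ne _ l hl]
    simp [constExp_apply]
    omega
  · obtain ⟨l', rfl⟩ : ∃ l', skipAt i l' = l := by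
      rcases Nat.lt_or_ge l i with h | h
      · exact ⟨l, by simp [skipAt, h]⟩
      · exact ⟨l - 1, by unfold skipAt; split_ifs <;> omega⟩
    rw [Finsupp.add_apply, Finsupp.mapDomain_apply (skipAt_injective i),
      Finsupp.single_eq_of_ne hl, constExp_apply, constExp_apply, zero_add]
    unfold skipAt
    split_ifs <;> first | rfl | omega

/-- The product of `(x_i - x_j) * (1 + x_j + x_i * x_j)` over `i < j < n`. -/
noncomputable def gogKernel (A : Type*) [CommRing A] (n : ℕ) : MvPolynomial ℕ A :=
  pairProd n fun i j => (X i - X j) * (1 + X j + X i * X j)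

/-- The coefficient of `(x_0 ⋯ x_{n-1}) ^ d` in the product of a polynomial with `gogKernel A n`. -/
noncomputable def gogCoeff (n d : ℕ) : MvPolynomial ℕ A →ₗ[A] A :=
  lcoeff A (constExp n d) ∘ₗ LinearMap.mulLeft A (gogKernel A n)

lemma gogCoeff_apply (n d : ℕ) (P : MvPolynomial ℕ A) :
    gogCoeff n d P = coeff (constExp n d) (gogKernel A n * P) := rfl

lemma gogCoeff_prod_X_mul (n d : ℕ) (P : MvPolynomial ℕ A) :
    gogCoeff n (d + 1) ((∏ i ∈ Finset.range n, X i) * P) = gogCoeff n d P := by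
  have h1 : constExp n (d + 1) = constExp n 1 + constExp n d := by
    ext; simp only [constExp_apply, Finsupp.add_apply]; split_ifs <;> ring
  have h2 : (∏ i ∈ Finset.range n, X i : MvPolynomial ℕ A) = monomial (constExp n 1) 1 := by
    rw [constExp, monomial_sum_one]
    rfl
  rw [gogCoeff_apply, mul_left_comm, h1, h2, coeff_monomial_mul, one_mul, gogCoeff_apply]

lemma rename_swap_kernel_mul {n l : ℕ} (hl : l + 1 < n) :
    rename (Equiv.swap l (l + 1)) ((1 + X l + X l * X (l + 1)) * gogKernel A n) =
      -((1 + X l + X l * X (l + 1)) * gogKernel A n) := by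
  set K : ℕ → ℕ → MvPolynomial ℕ A := fun i j => (X i - X j) * (1 + X j + X i * X j) with hK
  set S := ((Finset.range n ×ˢ Finset.range n).filter (fun p => p.1 < p.2)) with hS
  have hmem : (l, l + 1) ∈ S := by simp [hS]; omega
  have hprod : gogKernel A n = K l (l + 1) * ∏ p ∈ S.erase (l, l + 1), K p.1 p.2 := by
    rw [gogKernel, pairProd_eq_prod_filter, ← hS, ← Finset.mul_prod_erase S _ hmem]
  have hinv : rename (Equiv.swap l (l + 1)) (∏ p ∈ S.erase (l, l + 1), K p.1 p.2) =
      ∏ p ∈ S.erase (l, l + 1), K p.1 p.2 := by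
    rw [map_prod]
    refine Finset.prod_equiv ((Equiv.swap l (l + 1)).prodCongr (Equiv.swap l (l + 1))) ?_ ?_
    · rintro ⟨a, b⟩
      simp only [hS, Finset.mem_erase, Finset.mem_filter, Finset.mem_product, Finset.mem_range,
        Equiv.prodCongr_apply, Prod.map_apply, ne_eq, Prod.mk.injEq, Equiv.swap_apply_def]
      split_ifs <;> omega
    · rintro ⟨a, b⟩ _
      simp [hK]
  rw [hprod, map_mul, map_mul, hinv]
  simp only [hK, map_add, map_mul, map_sub, map_one, rename_X, Equiv.swap_apply_left,
    Equiv.swap_apply_right]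
  ring

/-- Multiplying the kernel by `1 + x_l + x_l * x_{l+1}` makes it antisymmetric in `x_l, x_{l+1}`. -/
lemma gogCoeff_eq_zero_of_symm [IsAddTorsionFree A] {n l : ℕ} (hl : l + 1 < n) (d : ℕ)
    {P : MvPolynomial ℕ A} (hP : rename (Equiv.swap l (l + 1)) P = P) :
    gogCoeff n d ((1 + X l + X l * X (l + 1)) * P) = 0 := by
  set F := (1 + X l + X l * X (l + 1)) * gogKernel A n with hF
  have hF' : gogKernel A n * ((1 + X l + X l * X (l + 1)) * P) = F * P := by rw [hF]; ring
  have hswap : rename (Equiv.swap l (l + 1)) (F * P) = -(F * P) := by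
    rw [map_mul, hP, hF, rename_swap_kernel_mul hl, neg_mul]
  have hexp : (constExp n d).mapDomain (Equiv.swap l (l + 1)) = constExp n d := by
    ext i
    rw [Finsupp.mapDomain_equiv_apply, constExp_apply, constExp_apply, Equiv.symm_swap,
      Equiv.swap_apply_def]
    split_ifs <;> first | rfl | omega
  have h := coeff_rename_mapDomain _ (Equiv.swap l (l + 1)).injective (F * P) (constExp n d)
  rw [hexp, hswap, coeff_neg] at h
  rw [gogCoeff_apply, hF']
  exact neg_eq_self.mp h

lemma gogCoeff_succ_prod (n : ℕ) (f : ℕ → Polynomial A) :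
    gogCoeff (n + 1) n (∏ l ∈ Finset.range (n + 1), Polynomial.aeval (X l) (f l)) =
      ∑ i ∈ Finset.range (n + 1), (-1) ^ i * (f i).coeff 0 *
        gogCoeff n n (∏ l ∈ Finset.range n, if l < i then Polynomial.aeval (X l) (f l)
          else (1 + X l) * Polynomial.aeval (X l) (f (l + 1))) := by
  rw [gogCoeff_apply, gogKernel, pairProd_mul, pairProd_sub_succ, Finset.sum_mul, Finset.sum_mul,
    coeff_sum]
  refine Finset.sum_congr rfl fun i hi => ?_
  have hi : i ≤ n := by simpa [Nat.lt_succ_iff] using hi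
  rw [pairProd_succ_eq_mul_skipAt _ hi, prod_range_succ_eq_mul_skipAt _ hi,
    constExp_succ_left hi]
  have hX : (-1) ^ i * (X i : MvPolynomial ℕ A) ^ n = monomial (Finsupp.single i n) ((-1) ^ i) := by
    rw [X_pow_eq_monomial, ← mul_one ((-1 : A) ^ i), ← C_mul_monomial]
    simp
  rw [hX]
  simp only [mul_assoc]
  rw [coeff_monomial_mul, coeff_mapDomain_skipAt]
  congr 1
  rw [gogCoeff_apply, gogKernel, ← coeff_C_mul, pairProd_mul]
  congr 1
  have h0 : dropVar i (Polynomial.aeval (X i) (f i)) = (C ((f i).coeff 0) : MvPolynomial ℕ A) := by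
    rw [← Polynomial.aeval_algHom_apply, dropVar_X_self, Polynomial.aeval_def,
      Polynomial.eval₂_at_zero]
    rfl
  have hp : ∀ h : ℕ → ℕ → MvPolynomial ℕ A, dropVar i (pairProd n h) =
      pairProd n (fun a b => dropVar i (h a b)) := by
    intro h; simp [pairProd, map_prod]
  have hm : ∀ l ∈ Finset.range n, (if l < i then Polynomial.aeval (X l) (f l)
        else (1 + X l) * Polynomial.aeval (X l) (f (l + 1)) : MvPolynomial ℕ A) =
      dropVar i (if l < i then 1 + X i + X l * X i else 1 + X (l + 1) + X i * X (l + 1)) *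
      dropVar i (Polynomial.aeval (X (skipAt i l)) (f (skipAt i l))) := by
    intro l _
    rw [← Polynomial.aeval_algHom_apply, dropVar_X_skipAt]
    have := dropVar_X_skipAt (A := A) i l
    split_ifs with h
    · simp [dropVar_X_self, skipAt, h]
    · simp only [skipAt, h, if_false] at this
      simp [dropVar_X_self, skipAt, h, this]
  rw [Finset.prod_congr rfl hm, Finset.prod_mul_distrib]
  simp only [map_mul, hp, h0, map_prod, map_sub, map_add, map_one, dropVar_X_skipAt]
  ring

end ConstantTerm

section Rows

/-- The strictly increasing rows `c` with entries `c 1 < ⋯ < c k` (and zero elsewhere) that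
interlace with `b`, i.e. `b j ≤ c j ≤ b (j + 1)`; see `mem_rowsAbove`. -/
noncomputable def rowsAbove (b : ℕ → ℤ) : ℕ → Finset (ℕ → ℤ)
  | 0 => {0}
  | j + 1 => ((rowsAbove b j ×ˢ Finset.Icc (b (j + 1)) (b (j + 2))).filter
      fun p => p.1 j < p.2).image fun p => Function.update p.1 (j + 1) p.2

lemma mem_rowsAbove {b : ℕ → ℤ} (hb : 0 < b 1) {k : ℕ} {c : ℕ → ℤ} :
    c ∈ rowsAbove b k ↔ (∀ j, 1 ≤ j → j ≤ k → b j ≤ c j ∧ c j ≤ b (j + 1)) ∧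
      (∀ j, 1 ≤ j → j < k → c j < c (j + 1)) ∧ ∀ j, ¬ (1 ≤ j ∧ j ≤ k) → c j = 0 := by
  induction k generalizing c with
  | zero =>
    simp only [rowsAbove, Finset.mem_singleton]
    constructor
    · rintro rfl
      exact ⟨fun j _ _ => by omega, fun j _ _ => by omega, fun _ _ => rfl⟩
    · rintro ⟨-, -, h⟩
      exact funext fun j => h j (by omega)
  | succ k ih =>
    simp only [rowsAbove, Finset.mem_image, Finset.mem_filter, Finset.mem_product, Finset.mem_Icc,
      Prod.exists]
    constructor
    · rintro ⟨c, v, ⟨⟨hc, hv⟩, hlt⟩, rfl⟩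
      obtain ⟨h1, h2, h3⟩ := ih.mp hc
      refine ⟨fun j hj hjk => ?_, fun j hj hjk => ?_, fun j hj => ?_⟩
      · rcases eq_or_ne j (k + 1) with rfl | hne
        · simpa using hv
        · rw [Function.update_of_ne hne]
          exact h1 j hj (by omega)
      · rw [Function.update_of_ne (by omega)]
        rcases eq_or_ne j k with rfl | hne
        · simpa using hlt
        · rw [Function.update_of_ne (by omega)]
          exact h2 j hj (by omega)
      · rw [Function.update_of_ne (by omega)]
        exact h3 j (by omega)
    · rintro ⟨h1, h2, h3⟩
      refine ⟨Function.update c (k + 1) 0, c (k + 1),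
        ⟨⟨ih.mpr ⟨?_, ?_, ?_⟩, h1 _ (by omega) le_rfl⟩, ?_⟩, by simp⟩
      · intro j hj hjk
        rw [Function.update_of_ne (by omega)]
        exact h1 j hj (by omega)
      · intro j hj hjk
        rw [Function.update_of_ne (by omega), Function.update_of_ne (by omega)]
        exact h2 j hj (by omega)
      · intro j hj
        rcases eq_or_ne j (k + 1) with rfl | hne
        · simp
        · rw [Function.update_of_ne hne]
          exact h3 j (by omega)
      · rw [Function.update_of_ne (by omega)]
        rcases Nat.eq_zero_or_pos k with rfl | hk
        · rw [h3 0 (by omega)]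
          exact hb.trans_le (h1 1 le_rfl le_rfl).1
        · exact h2 k hk (by omega)

variable {R : Type*} [CommRing R]

/-- The sum over `rowsAbove b k` of the weights `g 0 (c 1) * ⋯ * g (k - 1) (c k)`. -/
noncomputable def rowSum (b : ℕ → ℤ) (g : ℕ → ℤ → R) (k : ℕ) : R :=
  ∑ c ∈ rowsAbove b k, ∏ l ∈ Finset.range k, g l (c (l + 1))

lemma sum_rowsAbove_succ {b : ℕ → ℤ} (hb : 0 < b 1) (k : ℕ) (F : (ℕ → ℤ) → R) :
    ∑ c ∈ rowsAbove b (k + 1), F c = ∑ c ∈ rowsAbove b k,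
      ∑ v ∈ Finset.Icc (b (k + 1)) (b (k + 2)),
        if c k < v then F (Function.update c (k + 1) v) else 0 := by
  rw [rowsAbove, Finset.sum_image, Finset.sum_filter, Finset.sum_product]
  rintro ⟨c, v⟩ hp ⟨c', v'⟩ hp' h
  simp only [Finset.coe_filter, Finset.mem_product, Set.mem_ofPred_eq] at hp hp' h
  have hc := ((mem_rowsAbove hb).mp hp.1.1).2.2 (k + 1) (by omega)
  have hc' := ((mem_rowsAbove hb).mp hp'.1.1).2.2 (k + 1) (by omega)
  have hv : v = v' := by simpa using congrFun h (k + 1)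
  refine Prod.ext (funext fun j => ?_) hv
  rcases eq_or_ne j (k + 1) with rfl | hne
  · exact hc.trans hc'.symm
  · simpa [Function.update_of_ne hne] using congrFun h j

lemma prod_update_row (g : ℕ → ℤ → R) (c : ℕ → ℤ) (k : ℕ) (v : ℤ) :
    ∏ l ∈ Finset.range (k + 1), g l (Function.update c (k + 1) v (l + 1)) =
      (∏ l ∈ Finset.range k, g l (c (l + 1))) * g k v := by
  rw [Finset.prod_range_succ, Function.update_self]
  congr 1
  refine Finset.prod_congr rfl fun l hl => ?_
  rw [Function.update_of_ne]
  have := Finset.mem_range.mp hl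
  omega

lemma rowSum_zero (b : ℕ → ℤ) (g : ℕ → ℤ → R) : rowSum b g 0 = 1 := by
  simp [rowSum, rowsAbove]

lemma rowSum_one {b : ℕ → ℤ} (hb : 0 < b 1) (g : ℕ → ℤ → R) :
    rowSum b g 1 = ∑ v ∈ Finset.Icc (b 1) (b 2), g 0 v := by
  rw [rowSum, sum_rowsAbove_succ hb, rowsAbove, Finset.sum_singleton]
  refine Finset.sum_congr rfl fun v hv => ?_
  rw [if_pos, prod_update_row]
  · simp
  · exact hb.trans_le (Finset.mem_Icc.mp hv).1

lemma rowSum_add_two {b : ℕ → ℤ} (hb : 0 < b 1) (g : ℕ → ℤ → R) {k : ℕ}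
    (h1 : b (k + 1) < b (k + 2)) (h2 : b (k + 2) < b (k + 3)) :
    rowSum b g (k + 2) =
      rowSum b g (k + 1) * ∑ v ∈ Finset.Icc (b (k + 2)) (b (k + 3)), g (k + 1) v -
        rowSum b g k * (g k (b (k + 2)) * g (k + 1) (b (k + 2))) := by
  have hk : rowSum b g k * g k (b (k + 2)) = ∑ c ∈ rowsAbove b (k + 1),
      if c (k + 1) = b (k + 2) then ∏ l ∈ Finset.range (k + 1), g l (c (l + 1)) else 0 := by
    rw [sum_rowsAbove_succ hb, rowSum, Finset.sum_mul]
    refine Finset.sum_congr rfl fun c hc => ?_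
    have hlt : c k < b (k + 2) := by
      obtain ⟨hc1, -, hc3⟩ := (mem_rowsAbove hb).mp hc
      rcases Nat.eq_zero_or_pos k with rfl | hk
      · rw [hc3 0 (by omega)]
        exact hb.trans h1
      · exact (hc1 k hk le_rfl).2.trans_lt h1
    rw [Finset.sum_eq_single_of_mem (b (k + 2)) (Finset.mem_Icc.mpr ⟨h1.le, le_rfl⟩)]
    · rw [if_pos hlt, Function.update_self, if_pos rfl, prod_update_row]
    · intro v _ hv
      rw [Function.update_self, if_neg hv, ite_self]
  rw [← mul_assoc, hk, rowSum, sum_rowsAbove_succ hb, rowSum, Finset.sum_mul, Finset.sum_mul,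
    ← Finset.sum_sub_distrib]
  refine Finset.sum_congr rfl fun c hc => ?_
  have hle : c (k + 1) ≤ b (k + 2) := (((mem_rowsAbove hb).mp hc).1 (k + 1) (by omega) le_rfl).2
  simp only [prod_update_row g c (k + 1)]
  split_ifs with heq
  · have hmem : b (k + 2) ∈ Finset.Icc (b (k + 2)) (b (k + 3)) :=
      Finset.mem_Icc.mpr ⟨le_rfl, h2.le⟩
    rw [← Finset.add_sum_erase _ _ hmem, ← Finset.add_sum_erase _ _ hmem, heq,
      if_neg (lt_irrefl _), zero_add, mul_add, add_sub_cancel_left, Finset.mul_sum]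
    refine Finset.sum_congr rfl fun v hv => if_pos ?_
    rw [Finset.mem_erase, Finset.mem_Icc] at hv
    omega
  · rw [zero_mul, sub_zero, Finset.mul_sum]
    refine Finset.sum_congr rfl fun v hv => if_pos ?_
    rw [Finset.mem_Icc] at hv
    omega

/-- The alternating sum `∑ i ≤ k, (-1) ^ i * (L 0 ⋯ L (i - 1)) * (U i ⋯ U (k - 1))`. -/
noncomputable def splitSum (L U : ℕ → R) (k : ℕ) : R :=
  ∑ i ∈ Finset.range (k + 1), (-1) ^ i * ∏ l ∈ Finset.range k, if l < i then L l else U l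

lemma splitSum_zero (L U : ℕ → R) : splitSum L U 0 = 1 := by
  simp [splitSum]

lemma splitSum_succ (L U : ℕ → R) (k : ℕ) :
    splitSum L U (k + 1) =
      splitSum L U k * U k + (-1) ^ (k + 1) * ∏ l ∈ Finset.range (k + 1), L l := by
  rw [splitSum, Finset.sum_range_succ, splitSum, Finset.sum_mul]
  congr 1
  · refine Finset.sum_congr rfl fun i hi => ?_
    rw [Finset.prod_range_succ, if_neg, mul_assoc]
    have := Finset.mem_range.mp hi
    omega
  · congr 1
    refine Finset.prod_congr rfl fun l hl => if_pos (Finset.mem_range.mp hl)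

lemma splitSum_add_two (L U : ℕ → R) (k : ℕ) :
    splitSum L U (k + 2) =
      splitSum L U (k + 1) * (U (k + 1) - L (k + 1)) + splitSum L U k * (U k * L (k + 1)) := by
  rw [splitSum_succ L U (k + 1), splitSum_succ L U k, Finset.prod_range_succ _ (k + 1)]
  ring

end Rows

section Antisymmetry

open MvPolynomial

variable {A : Type*} [CommRing A]

/-- The polynomial is invariant under adjacent transpositions of the first `j` variables. -/
def SymmBelow (j : ℕ) (Z : MvPolynomial ℕ A) : Prop :=
  ∀ l, l + 1 < j → rename (Equiv.swap l (l + 1)) Z = Z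

lemma SymmBelow.mono {i j : ℕ} (h : i ≤ j) {Z : MvPolynomial ℕ A} (hZ : SymmBelow j Z) :
    SymmBelow i Z := fun l hl => hZ l (by omega)

lemma SymmBelow.mul {j : ℕ} {Y Z : MvPolynomial ℕ A} (hY : SymmBelow j Y) (hZ : SymmBelow j Z) :
    SymmBelow j (Y * Z) := fun l hl => by rw [map_mul, hY l hl, hZ l hl]

lemma rename_swap_aeval (i j l : ℕ) (p : Polynomial A) :
    rename (Equiv.swap i j) (Polynomial.aeval (X l : MvPolynomial ℕ A) p) =
      Polynomial.aeval (X (Equiv.swap i j l)) p := by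
  rw [← Polynomial.aeval_algHom_apply, rename_X]

lemma symmBelow_aeval {j l : ℕ} (h : j ≤ l) (p : Polynomial A) :
    SymmBelow j (Polynomial.aeval (X l : MvPolynomial ℕ A) p) := fun i hi => by
  rw [rename_swap_aeval, Equiv.swap_apply_of_ne_of_ne (by omega) (by omega)]

lemma symmBelow_prod_aeval {j : ℕ} {s : Finset ℕ} (hs : ∀ l ∈ s, j ≤ l) (p : ℕ → Polynomial A) :
    SymmBelow j (∏ l ∈ s, Polynomial.aeval (X l : MvPolynomial ℕ A) (p l)) := fun i hi => by
  rw [map_prod]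
  exact Finset.prod_congr rfl fun l hl => symmBelow_aeval (hs l hl) (p l) i hi

lemma rename_swap_splitSum (L R : ℕ → Polynomial A) (k : ℕ) :
    rename (Equiv.swap k (k + 1))
      (splitSum (fun l => Polynomial.aeval (X l : MvPolynomial ℕ A) (L l))
        (fun l => Polynomial.aeval (X l) (R l)) k) =
    splitSum (fun l => Polynomial.aeval (X l : MvPolynomial ℕ A) (L l))
      (fun l => Polynomial.aeval (X l) (R l)) k := by
  simp only [splitSum, map_sum, map_mul, map_pow, map_neg, map_one, map_prod]
  refine Finset.sum_congr rfl fun i _ => ?_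
  congr 1
  refine Finset.prod_congr rfl fun l hl => ?_
  have := Finset.mem_range.mp hl
  split_ifs <;> rw [rename_swap_aeval, Equiv.swap_apply_of_ne_of_ne (by omega) (by omega)]

lemma gogCoeff_splitSum_mul_eq_rowSum_mul [IsAddTorsionFree A] {n : ℕ} (d k : ℕ)
    (hkn : k ≤ n) {b : ℕ → ℤ} (hb : 0 < b 1) (hbs : ∀ j, 1 ≤ j → j ≤ k → b j < b (j + 1))
    (L R : ℕ → Polynomial A) (g : ℕ → ℤ → Polynomial A) (S : ℕ → Polynomial A)
    (hg : ∀ j, j < k → ∑ v ∈ Finset.Icc (b (j + 1)) (b (j + 2)), g j v = R j - L j)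
    (hR : ∀ j, j + 1 < k → R j = (1 + Polynomial.X) * S j)
    (hL : ∀ j, j + 1 < k → L (j + 1) = S j)
    (hg1 : ∀ j, j + 1 < k → g j (b (j + 2)) = Polynomial.X * S j)
    (hg2 : ∀ j, j + 1 < k → g (j + 1) (b (j + 2)) = Polynomial.X * S j)
    {Z : MvPolynomial ℕ A} (hZ : SymmBelow k Z) :
    gogCoeff n d (splitSum (fun l => Polynomial.aeval (X l) (L l))
        (fun l => Polynomial.aeval (X l) (R l)) k * Z) =
      gogCoeff n d (rowSum b (fun l v => Polynomial.aeval (X l) (g l v)) k * Z) := by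
  set U := splitSum (fun l => Polynomial.aeval (X l : MvPolynomial ℕ A) (L l))
    (fun l => Polynomial.aeval (X l) (R l)) with hU
  set T := rowSum b (fun l v => Polynomial.aeval (X l : MvPolynomial ℕ A) (g l v)) with hT
  have hsum : ∀ j, j < k → ∑ v ∈ Finset.Icc (b (j + 1)) (b (j + 2)),
      Polynomial.aeval (X j : MvPolynomial ℕ A) (g j v) = Polynomial.aeval (X j) (R j - L j) :=
    fun j hj => by rw [← map_sum, hg j hj]
  have main : ∀ j, j ≤ k → ∀ Z, SymmBelow j Z → gogCoeff n d ((U j - T j) * Z) = 0 := by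
    intro j
    induction j using Nat.twoStepInduction with
    | zero =>
      intro _ Z _
      rw [hU, hT, splitSum_zero, rowSum_zero, sub_self, zero_mul, map_zero]
    | one =>
      intro h1 Z _
      rw [hU, hT, splitSum_succ, splitSum_zero, rowSum_one hb, hsum 0 h1, map_sub]
      simp
    | more j ih0 ih1 =>
      intro hj Z hZ
      have hD : SymmBelow j (Polynomial.aeval (X j : MvPolynomial ℕ A) (g j (b (j + 2))) *
          Polynomial.aeval (X (j + 1)) (g (j + 1) (b (j + 2)))) :=
        (symmBelow_aeval le_rfl _).mul (symmBelow_aeval (by omega) _)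
      have e1 := ih1 (by omega) _ ((symmBelow_aeval le_rfl (R (j + 1) - L (j + 1))).mul
        (hZ.mono (by omega)))
      have e0 := ih0 (by omega) _ (hD.mul (hZ.mono (by omega)))
      have e2 : gogCoeff n d ((1 + X j + X j * X (j + 1)) * (U j *
          (Polynomial.aeval (X j) (S j) * Polynomial.aeval (X (j + 1)) (S j)) * Z)) = 0 := by
        refine gogCoeff_eq_zero_of_symm (by omega) d ?_
        rw [map_mul, map_mul, map_mul, hZ j (by omega), hU, rename_swap_splitSum,
          rename_swap_aeval, rename_swap_aeval, Equiv.swap_apply_left, Equiv.swap_apply_right,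
          mul_comm (Polynomial.aeval (X (j + 1)) (S j))]
      have hsplit : (U (j + 2) - T (j + 2)) * Z =
          (U (j + 1) - T (j + 1)) * (Polynomial.aeval (X (j + 1)) (R (j + 1) - L (j + 1)) * Z) -
          (U j - T j) * (Polynomial.aeval (X j) (g j (b (j + 2))) *
            Polynomial.aeval (X (j + 1)) (g (j + 1) (b (j + 2))) * Z) +
          (1 + X j + X j * X (j + 1)) * (U j *
            (Polynomial.aeval (X j) (S j) * Polynomial.aeval (X (j + 1)) (S j)) * Z) := by
        have hu : U (j + 2) = _ := splitSum_add_two _ _ j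
        have ht : T (j + 2) = _ := rowSum_add_two hb _ (hbs (j + 1) (by omega) (by omega))
          (hbs (j + 2) (by omega) (by omega))
        rw [hu, ht, hsum (j + 1) (by omega), map_sub, hR j (by omega), hL j (by omega),
          hg1 j (by omega), hg2 j (by omega)]
        simp only [map_mul, map_add, map_one, Polynomial.aeval_X, ← hU, ← hT]
        ring
      rw [hsplit, map_add, map_sub, e0, e1, e2, sub_zero, add_zero]
  have := main k le_rfl Z hZ
  rwa [sub_mul, map_sub, sub_eq_zero] at this

end Antisymmetry

section Recursion

open MvPolynomial

variable {A : Type*} [CommRing A]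

/-- The factor of the `l`-th variable (counted from `0`) in the constant term, multiplied by
`X ^ (n - 1)`. -/
noncomputable def gogFactor (Q : A) (m k : ℕ) (b : ℕ → ℤ) (l : ℕ) : Polynomial A :=
  if l < k then (1 + Polynomial.X) ^ (b (l + 1)).toNat
  else (1 + Polynomial.C Q * Polynomial.X) * (1 + Polynomial.X) ^ (m + k) * Polynomial.X ^ (l - k)

/-- The constant term attached to the bottom row `b` of an `(m, n, k)`-Gog trapezoid, with
variables counted from `0`. -/
noncomputable def gogConstTerm (Q : A) (m n k : ℕ) (b : ℕ → ℤ) : A :=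
  gogCoeff n (n - 1) (∏ l ∈ Finset.range n, Polynomial.aeval (X l) (gogFactor Q m k b l))

/-- The row `b` extended by the entries `m + k + 1` to the right of position `k`. -/
def extendRow (m k : ℕ) (b : ℕ → ℤ) (j : ℕ) : ℤ := if j ≤ k then b j else m + k + 1

lemma coeff_zero_gogFactor (Q : A) (m k : ℕ) (b : ℕ → ℤ) (l : ℕ) :
    (gogFactor Q m k b l).coeff 0 = if l ≤ k then 1 else 0 := by
  rw [Polynomial.coeff_zero_eq_eval_zero, gogFactor]
  split_ifs with h1 h2 h2
  · simp
  · omega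
  · simp [Nat.sub_eq_zero_of_le h2]
  · simp [show l - k ≠ 0 by omega]

lemma sum_Icc_X_mul_one_add_X_pow {p q : ℤ} (hp : 0 ≤ p) (hpq : p ≤ q) :
    ∑ v ∈ Finset.Icc p q, (Polynomial.X * (1 + Polynomial.X) ^ v.toNat : Polynomial A) =
      (1 + Polynomial.X) ^ (q.toNat + 1) - (1 + Polynomial.X) ^ p.toNat := by
  induction q, hpq using Int.leInduction with
  | base => simp; ring
  | succ q hq ih =>
    have : Finset.Icc p (q + 1) = insert (q + 1) (Finset.Icc p q) := by
      ext; simp only [Finset.mem_Icc, Finset.mem_insert]; omega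
    rw [this, Finset.sum_insert (by simp), ih, Int.toNat_add (by omega) (by omega)]
    simp; ring

/-- Removing the bottom row: the constant terms satisfy the recursion of the Gog trapezoids. -/
lemma gogConstTerm_succ [IsAddTorsionFree A] (Q : A) {m n k : ℕ} (hk : 1 ≤ k) (hkn : k ≤ n + 1)
    {b : ℕ → ℤ} (hb : 0 < b 1) (hbk : b k ≤ m + k) (hbs : ∀ j, 1 ≤ j → j < k → b j < b (j + 1)) :
    gogConstTerm Q m (n + 1) k b = ∑ c ∈ rowsAbove (extendRow m k b) (min k n),
      (if k ≤ n ∧ c k = m + k + 1 then Q else 1) * gogConstTerm Q (m + 1) n (min k n) c := by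
  have hpos : ∀ j, 1 ≤ j → j ≤ k → 0 < b j := by
    intro j hj
    induction j, hj using Nat.le_induction with
    | base => exact fun _ => hb
    | succ j hj ih => exact fun h => (ih (by omega)).trans (hbs j hj (by omega))
  have hle : ∀ j, 1 ≤ j → j ≤ k → b j ≤ m + k := by
    intro j hj hjk
    induction hjk using Nat.decreasingInduction with
    | self => exact hbk
    | of_succ i hi ih => exact (hbs i hj hi).le.trans (ih (by omega))
  set k' := min k n with hk'
  set L : ℕ → Polynomial A := fun l => (1 + Polynomial.X) ^ (b (l + 1)).toNat with hL
  set R : ℕ → Polynomial A := fun l =>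
    if l + 1 < k then (1 + Polynomial.X) ^ ((b (l + 2)).toNat + 1)
    else (1 + Polynomial.C Q * Polynomial.X) * (1 + Polynomial.X) ^ (m + k + 1) with hR
  set q : ℕ → ℤ → A := fun l v => if l + 1 = k ∧ v = m + k + 1 then Q else 1 with hq
  set g : ℕ → ℤ → Polynomial A := fun l v =>
    Polynomial.C (q l v) * (Polynomial.X * (1 + Polynomial.X) ^ v.toNat) with hg
  set Z : MvPolynomial ℕ A := ∏ l ∈ Finset.Ico k' n,
    Polynomial.aeval (X l) (Polynomial.X * gogFactor Q (m + 1) k' b l) with hZ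
  have hext : ∀ j, j ≤ k → extendRow m k b j = b j := fun j hj => if_pos hj
  have hexpand : gogConstTerm Q m (n + 1) k b =
      gogCoeff n n (splitSum (fun l => Polynomial.aeval (X l) (L l))
        (fun l => Polynomial.aeval (X l) (R l)) k' * Z) := by
    rw [gogConstTerm, Nat.add_sub_cancel, gogCoeff_succ_prod, splitSum, Finset.sum_mul, map_sum]
    rw [← Finset.sum_subset (s₁ := Finset.range (k' + 1))]
    · refine Finset.sum_congr rfl fun i hi => ?_
      have hi : i ≤ k' := by simpa [Nat.lt_succ_iff] using hi
      rw [coeff_zero_gogFactor, if_pos (by omega), mul_one]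
      rw [← smul_eq_mul, ← map_smul]
      congr 1
      rw [smul_eq_C_mul, ← Finset.prod_range_mul_prod_Ico _ (min_le_right k n), map_pow, map_neg,
        map_one, mul_assoc]
      congr 2
      · refine Finset.prod_congr rfl fun l hl => ?_
        have hl : l < k := by have := Finset.mem_range.mp hl; omega
        split_ifs with hli
        · rw [gogFactor, if_pos hl]
        · simp only [gogFactor, hR]
          split_ifs with h
          · simp; ring
          · obtain rfl : l + 1 = k := by omega
            simp; ring
      · refine Finset.prod_congr rfl fun l hl => ?_
        have hl := Finset.mem_Ico.mp hl
        have hkk : k' = k := by omega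
        rw [if_neg (by omega), gogFactor, gogFactor, if_neg (by omega), if_neg (by omega), hkk,
          show l + 1 - k = l - k + 1 by omega]
        simp; ring
    · exact Finset.range_subset_range.mpr (by omega)
    · intro i hi hi'
      simp only [Finset.mem_range] at hi hi'
      rw [coeff_zero_gogFactor, if_neg (by omega), mul_zero, zero_mul]
  have hZsymm : SymmBelow k' Z := symmBelow_prod_aeval (fun l hl => (Finset.mem_Ico.mp hl).1) _
  have hstrict : ∀ j, 1 ≤ j → j ≤ k → extendRow m k b j < extendRow m k b (j + 1) := by
    intro j hj hjk
    rw [hext j hjk]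
    rcases hjk.lt_or_eq with h | rfl
    · rw [hext _ h]
      exact hbs j hj h
    · rw [extendRow, if_neg (by omega)]
      omega
  have hq1 : ∀ (l : ℕ) (v : ℤ), v ≤ m + k → q l v = 1 := fun l v hv => if_neg (by omega)
  rw [hexpand, gogCoeff_splitSum_mul_eq_rowSum_mul n k' (min_le_right k n) (b := extendRow m k b)
    (by rwa [hext 1 hk]) (fun j hj hjk => hstrict j hj (by omega)) L R g
    (fun j => (1 + Polynomial.X) ^ (b (j + 2)).toNat) ?_ ?_ ?_ ?_ ?_ hZsymm]
  · rw [rowSum, Finset.sum_mul, map_sum]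
    refine Finset.sum_congr rfl fun c _ => ?_
    have hqc : ∏ l ∈ Finset.range k', q l (c (l + 1)) =
        if k ≤ n ∧ c k = m + k + 1 then Q else 1 := by
      obtain ⟨k, rfl⟩ : ∃ j, k = j + 1 := ⟨k - 1, by omega⟩
      have : ∀ l, q l (c (l + 1)) =
          if k = l then (if c (k + 1) = m + (k + 1 : ℕ) + 1 then Q else 1) else 1 := by
        intro l
        simp only [hq]
        split_ifs <;> first | rfl | grind
      simp only [this, Finset.prod_ite_eq, Finset.mem_range]
      split_ifs <;> first | rfl | omega
    have hprod : (∏ l ∈ Finset.range k',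
        Polynomial.aeval (X l : MvPolynomial ℕ A) (g l (c (l + 1)))) * Z =
        C (if k ≤ n ∧ c k = m + k + 1 then Q else 1) * ((∏ l ∈ Finset.range n, X l) *
          ∏ l ∈ Finset.range n, Polynomial.aeval (X l) (gogFactor Q (m + 1) k' c l)) := by
      rw [← hqc, map_prod, ← Finset.prod_mul_distrib,
        ← Finset.prod_range_mul_prod_Ico _ (min_le_right k n), ← mul_assoc,
        ← Finset.prod_mul_distrib]
      congr 1
      · refine Finset.prod_congr rfl fun l hl => ?_
        rw [gogFactor, if_pos (Finset.mem_range.mp hl)]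
        simp only [hg, map_mul, Polynomial.aeval_X, Polynomial.aeval_C]
        rfl
      · refine Finset.prod_congr rfl fun l hl => ?_
        have hl := (Finset.mem_Ico.mp hl).1
        rw [gogFactor, gogFactor, if_neg (by omega), if_neg (by omega), map_mul, Polynomial.aeval_X]
    rw [hprod, ← smul_eq_C_mul, map_smul, smul_eq_mul, gogConstTerm]
    congr 1
    rcases n with _ | n
    · simp
    · exact gogCoeff_prod_X_mul _ _ _
  · intro j hj
    have hjk : j + 1 ≤ k := by omega
    rw [hext _ hjk]
    have h0 := hpos (j + 1) (by omega) hjk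
    rcases hjk.lt_or_eq with h | h
    · rw [hext (j + 2) (by omega)]
      rw [Finset.sum_congr rfl (g := fun v => Polynomial.X * (1 + Polynomial.X) ^ v.toNat)]
      · rw [sum_Icc_X_mul_one_add_X_pow h0.le (hbs (j + 1) (by omega) (by omega)).le]
        simp only [hR, hL, if_pos h]
      · intro v hv
        have := hle (j + 2) (by omega) (by omega)
        simp only [hg]
        rw [hq1 j v (by have := (Finset.mem_Icc.mp hv).2; omega), map_one, one_mul]
    · have h3 := hle (j + 1) (by omega) hjk
      rw [extendRow, if_neg (by omega)]
      have hI : Finset.Icc (b (j + 1)) (m + k + 1 : ℤ) =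
          insert (m + k + 1 : ℤ) (Finset.Icc (b (j + 1)) (m + k)) := by
        ext; simp only [Finset.mem_Icc, Finset.mem_insert]; omega
      rw [hI, Finset.sum_insert (by simp), Finset.sum_congr rfl
        (g := fun v => Polynomial.X * (1 + Polynomial.X) ^ v.toNat)]
      · rw [sum_Icc_X_mul_one_add_X_pow h0.le h3]
        simp only [hR, hL, hg, hq, if_neg (show ¬ j + 1 < k by omega), h]
        rw [show ((m : ℤ) + k + 1).toNat = m + k + 1 by omega,
          show ((m : ℤ) + k).toNat = m + k by omega]
        simp; ring
      · intro v hv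
        simp only [hg]
        rw [hq1 j v (Finset.mem_Icc.mp hv).2, map_one, one_mul]
  · intro j hj
    simp only [hR, if_pos (show j + 1 < k by omega)]
    ring
  · intro j hj
    rfl
  · intro j hj
    simp only [hg]
    rw [hext _ (by omega), hq1 _ _ (hle _ (by omega) (by omega)), map_one, one_mul]
  · intro j hj
    simp only [hg]
    rw [hext _ (by omega), hq1 _ _ (hle _ (by omega) (by omega)), map_one, one_mul]

end Recursion

section Trapezoids

/-- The array `a` with row `n + 1` replaced by the first `k` entries of `b`. -/
noncomputable def appendRow (n k : ℕ) (b : ℕ → ℤ) (a : ℕ → ℕ → ℤ) : ℕ → ℕ → ℤ :=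
  fun i j => if i = n + 1 then (if 1 ≤ j ∧ j ≤ k then b j else 0) else a i j

lemma appendRow_last {n k j : ℕ} (b : ℕ → ℤ) (a : ℕ → ℕ → ℤ) (hj : 1 ≤ j) (hjk : j ≤ k) :
    appendRow n k b a (n + 1) j = b j := by
  simp [appendRow, hj, hjk]

lemma appendRow_of_ne {n i : ℕ} (k j : ℕ) (b : ℕ → ℤ) (a : ℕ → ℕ → ℤ) (hi : i ≠ n + 1) :
    appendRow n k b a i j = a i j := if_neg hi

lemma isGog_appendRow {m n k : ℕ} {b c : ℕ → ℤ} {a : ℕ → ℕ → ℤ} (hkn : k ≤ n + 1)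
    (hb : ∀ j, 1 ≤ j → j ≤ k → 1 ≤ b j ∧ b j ≤ m + j)
    (hbs : ∀ j, 1 ≤ j → j < k → b j < b (j + 1))
    (hc : ∀ j, 1 ≤ j → j ≤ min k n →
      extendRow m k b j ≤ c j ∧ c j ≤ extendRow m k b (j + 1))
    (ha : IsGog (m + 1) n (min k n) a) (hac : ∀ j ∈ Finset.Icc 1 (min k n), a n j = c j) :
    IsGog m (n + 1) k (appendRow n k b a) := by
  obtain ⟨h1, h2, h3, h4, h5⟩ := ha
  simp only [Finset.mem_Icc, IsGog, GogPos, extendRow] at *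
  refine ⟨fun i j h => ?_, fun i j h h' => ?_, fun i j h h' => ?_, fun i j h h' => ?_,
    fun i j h => ?_⟩
  · rcases eq_or_ne i (n + 1) with rfl | hi
    · rw [appendRow_last _ _ (by omega) (by omega)]
      have := hb j (by omega) (by omega)
      push_cast
      omega
    · rw [appendRow_of_ne _ _ _ _ hi]
      have := h1 i j (by omega)
      push_cast at this ⊢
      omega
  · rw [appendRow_of_ne k j b a (show i ≠ n + 1 by omega)]
    rcases eq_or_ne i n with rfl | hi
    · rw [appendRow_last _ _ (by omega) (by omega), hac j (by omega)]
      have := hc j (by omega) (by omega)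
      rw [if_pos (by omega)] at this
      exact this.1
    · rw [appendRow_of_ne _ _ _ _ (by omega)]
      exact h2 i j (by omega) (by omega)
  · rw [appendRow_of_ne k j b a (show i ≠ n + 1 by omega)]
    rcases eq_or_ne i n with rfl | hi
    · rw [appendRow_last _ _ (by omega) (by omega), hac j (by omega)]
      have := hc j (by omega) (by omega)
      rw [if_pos (by omega), if_pos (by omega)] at this
      exact this.2
    · rw [appendRow_of_ne _ _ _ _ (by omega)]
      exact h3 i j (by omega) (by omega)
  · rcases eq_or_ne i (n + 1) with rfl | hi
    · rw [appendRow_last _ _ (by omega) (by omega), appendRow_last _ _ (by omega) (by omega)]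
      exact hbs j (by omega) (by omega)
    · rw [appendRow_of_ne _ _ _ _ hi, appendRow_of_ne _ _ _ _ hi]
      exact h4 i j (by omega) (by omega)
  · rcases eq_or_ne i (n + 1) with rfl | hi
    · rw [appendRow, if_pos rfl, if_neg]
      omega
    · rw [appendRow_of_ne _ _ _ _ hi]
      exact h5 i j (by omega)

lemma exists_eq_appendRow {m n k : ℕ} {b : ℕ → ℤ} {a : ℕ → ℕ → ℤ} (hkn : k ≤ n + 1) (hk : 1 ≤ k)
    (hb1 : 0 < b 1) (ha : IsGog m (n + 1) k a) (hab : ∀ j ∈ Finset.Icc 1 k, a (n + 1) j = b j) :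
    ∃ c ∈ rowsAbove (extendRow m k b) (min k n), ∃ a', (IsGog (m + 1) n (min k n) a' ∧
      ∀ j ∈ Finset.Icc 1 (min k n), a' n j = c j) ∧ appendRow n k b a' = a := by
  obtain ⟨h1, h2, h3, h4, h5⟩ := ha
  simp only [Finset.mem_Icc, IsGog, GogPos] at *
  refine ⟨fun j => if 1 ≤ j ∧ j ≤ min k n then a n j else 0, ?_,
    fun i j => if i = n + 1 then 0 else a i j, ⟨⟨fun i j h => ?_, fun i j h h' => ?_,
    fun i j h h' => ?_, fun i j h h' => ?_, fun i j h => ?_⟩, fun j hj => ?_⟩, ?_⟩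
  · rw [mem_rowsAbove (by rwa [extendRow, if_pos hk])]
    refine ⟨fun j hj hjk => ?_, fun j hj hjk => ?_, fun j hj => if_neg hj⟩
    · rw [if_pos ⟨hj, hjk⟩, extendRow, if_pos (by omega), extendRow, ← hab j (by omega)]
      refine ⟨h2 n j (by omega) (by omega), ?_⟩
      split_ifs with h
      · rw [← hab (j + 1) (by omega)]
        exact h3 n j (by omega) (by omega)
      · have := (h1 n j (by omega)).2
        push_cast at this
        omega
    · rw [if_pos (by omega), if_pos (by omega)]
      exact h4 n j (by omega) (by omega)
  · beta_reduce
    rw [if_neg (by omega)]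
    have := h1 i j (by omega)
    push_cast at this ⊢
    omega
  · beta_reduce
    rw [if_neg (by omega), if_neg (by omega)]
    exact h2 i j (by omega) (by omega)
  · beta_reduce
    rw [if_neg (by omega), if_neg (by omega)]
    exact h3 i j (by omega) (by omega)
  · beta_reduce
    rw [if_neg (by omega), if_neg (by omega)]
    exact h4 i j (by omega) (by omega)
  · beta_reduce
    split_ifs
    · rfl
    · exact h5 i j (by omega)
  · beta_reduce
    rw [if_neg (by omega), if_pos (by omega)]
  · funext i j
    unfold appendRow
    split_ifs with hi hj
    · rw [hi, hab j (by omega)]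
    · exact (h5 i j (by omega)).symm
    · exact if_neg hi

lemma gogMaxAbove_appendRow {m n k : ℕ} {b c : ℕ → ℤ} {a : ℕ → ℕ → ℤ} (hk : 1 ≤ k)
    (hac : ∀ j ∈ Finset.Icc 1 (min k n), a n j = c j) :
    gogMaxAbove m (n + 1) k (appendRow n k b a) =
      (if k ≤ n ∧ c k = m + k + 1 then 1 else 0) + gogMaxAbove (m + 1) n (min k n) a := by
  have hset : (Finset.Icc 1 (n + 1)).filter (fun i => GogPos (n + 1) k i k ∧ i < n + 1 ∧
        appendRow n k b a i k = ((m + (n + 1 - i) + k : ℕ) : ℤ)) =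
      (if k ≤ n ∧ c k = m + k + 1 then {n} else ∅) ∪
        (Finset.Icc 1 n).filter (fun i => GogPos n (min k n) i (min k n) ∧ i < n ∧
          a i (min k n) = ((m + 1 + (n - i) + min k n : ℕ) : ℤ)) := by
    ext i
    simp only [Finset.mem_union, Finset.mem_filter, Finset.mem_Icc]
    simp only [GogPos]
    rcases Nat.lt_or_ge n k with hnk | hkn
    · rw [if_neg (by omega)]
      simp only [Finset.notMem_empty, false_or]
      omega
    · rw [min_eq_left hkn] at hac ⊢
      have hck := hac k (Finset.mem_Icc.mpr ⟨hk, le_rfl⟩)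
      rcases eq_or_ne i n with rfl | hi
      · rw [appendRow_of_ne _ _ _ _ (by omega), hck]
        split_ifs with h
        · simp only [Finset.mem_singleton, true_or, iff_true]
          push_cast
          omega
        · simp only [Finset.notMem_empty, false_or]
          push_cast
          omega
      · have hn : ¬ i ∈ (if k ≤ n ∧ c k = m + k + 1 then {n} else ∅ : Finset ℕ) := by
          split_ifs <;> simp [hi]
        simp only [hn, false_or]
        rcases eq_or_ne i (n + 1) with rfl | hi'
        · omega
        · rw [appendRow_of_ne _ _ _ _ hi']
          push_cast
          omega
  rw [gogMaxAbove, gogMaxAbove, hset, Finset.card_union_of_disjoint]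
  · congr 1
    split_ifs <;> simp
  · rw [Finset.disjoint_right]
    intro i hi
    have hi := (Finset.mem_filter.mp hi).2.2.1
    split_ifs
    · simp only [Finset.mem_singleton]
      omega
    · simp

/-- The Gog trapezoids with a given bottom row form a finite set, whose generating function is
the constant term `gogConstTerm`. -/
lemma exists_finset_isGog_sum_eq {A : Type*} [CommRing A] [IsAddTorsionFree A] (Q : A)
    {m n k : ℕ} {b : ℕ → ℤ} (hkn : k ≤ n) (hk : 1 ≤ n → 1 ≤ k)
    (hb : ∀ j, 1 ≤ j → j ≤ k → 1 ≤ b j ∧ b j ≤ m + j)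
    (hbs : ∀ j, 1 ≤ j → j < k → b j < b (j + 1)) :
    ∃ S : Finset (ℕ → ℕ → ℤ),
      (∀ a, a ∈ S ↔ IsGog m n k a ∧ ∀ j ∈ Finset.Icc 1 k, a n j = b j) ∧
      ∑ a ∈ S, Q ^ gogMaxAbove m n k a = gogConstTerm Q m n k b := by
  induction n generalizing m k b with
  | zero =>
    obtain rfl : k = 0 := by omega
    have hpos : ∀ i j, ¬ GogPos 0 0 i j := fun i j h => by unfold GogPos at h; omega
    refine ⟨{0}, fun a => ?_, ?_⟩
    · rw [Finset.mem_singleton]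
      constructor
      · rintro rfl
        exact ⟨⟨fun i j h => (hpos i j h).elim, fun i j h => (hpos i j h).elim,
          fun i j h => (hpos i j h).elim, fun i j h => (hpos i j h).elim, fun _ _ _ => rfl⟩,
          by simp⟩
      · rintro ⟨⟨-, -, -, -, h⟩, -⟩
        exact funext fun i => funext fun j => h i j (hpos i j)
    · simp [gogMaxAbove, gogConstTerm, gogCoeff_apply, gogKernel, pairProd, constExp]
  | succ n ih =>
    have hk1 := hk (by omega)
    have hb1 : 0 < b 1 := (hb 1 le_rfl hk1).1
    have hext1 : 0 < extendRow m k b 1 := by rwa [extendRow, if_pos hk1]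
    have hex : ∀ c, ∃ S : Finset (ℕ → ℕ → ℤ), c ∈ rowsAbove (extendRow m k b) (min k n) →
        (∀ a, a ∈ S ↔ IsGog (m + 1) n (min k n) a ∧
          ∀ j ∈ Finset.Icc 1 (min k n), a n j = c j) ∧
        ∑ a ∈ S, Q ^ gogMaxAbove (m + 1) n (min k n) a =
          gogConstTerm Q (m + 1) n (min k n) c := by
      intro c
      by_cases hc : c ∈ rowsAbove (extendRow m k b) (min k n)
      · obtain ⟨h1, h2, -⟩ := (mem_rowsAbove hext1).mp hc
        obtain ⟨S, hS⟩ := ih (m := m + 1) (k := min k n) (b := c) (min_le_right _ _) (by omega) (by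
          intro j hj hjk
          have h := h1 j hj hjk
          have hbj := hb j hj (by omega)
          rw [extendRow, if_pos (by omega), extendRow] at h
          push_cast
          split_ifs at h with hlt
          · have := hb (j + 1) (by omega) hlt
            push_cast at this
            omega
          · omega) h2
        exact ⟨S, fun _ => hS⟩
      · exact ⟨∅, fun h => (hc h).elim⟩
    choose T hT using hex
    refine ⟨(rowsAbove (extendRow m k b) (min k n)).biUnion
      fun c => (T c).image (appendRow n k b), fun a => ?_, ?_⟩
    · simp only [Finset.mem_biUnion, Finset.mem_image]
      constructor
      · rintro ⟨c, hc, a', ha', rfl⟩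
        obtain ⟨hg, hac⟩ := ((hT c hc).1 a').mp ha'
        refine ⟨isGog_appendRow hkn hb hbs ((mem_rowsAbove hext1).mp hc).1 hg hac, fun j hj => ?_⟩
        rw [Finset.mem_Icc] at hj
        exact appendRow_last _ _ hj.1 hj.2
      · rintro ⟨hg, hab⟩
        obtain ⟨c, hc, a', ha', rfl⟩ := exists_eq_appendRow hkn hk1 hb1 hg hab
        exact ⟨c, hc, a', ((hT c hc).1 a').mpr ha', rfl⟩
    · rw [Finset.sum_biUnion, gogConstTerm_succ Q hk1 hkn hb1 (hb k hk1 le_rfl).2 hbs]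
      · refine Finset.sum_congr rfl fun c hc => ?_
        rw [Finset.sum_image, ← (hT c hc).2, Finset.mul_sum]
        · refine Finset.sum_congr rfl fun a ha => ?_
          rw [gogMaxAbove_appendRow hk1 (((hT c hc).1 a).mp ha).2, pow_add]
          congr 1
          split_ifs <;> simp
        · intro a ha a' ha' h
          have hz : ∀ a ∈ T c, ∀ j, a (n + 1) j = 0 := fun a ha j =>
            (((hT c hc).1 a).mp ha).1.2.2.2.2 (n + 1) j fun h => by unfold GogPos at h; omega
          funext i j
          rcases eq_or_ne i (n + 1) with rfl | hi
          · rw [hz a ha, hz a' ha']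
          · simpa only [appendRow_of_ne _ _ _ _ hi] using congrFun (congrFun h i) j
      · intro c hc c' hc' hne
        rw [Function.onFun, Finset.disjoint_left]
        intro a ha ha'
        obtain ⟨a₁, h₁, rfl⟩ := Finset.mem_image.mp ha
        obtain ⟨a₂, h₂, h⟩ := Finset.mem_image.mp ha'
        refine hne (funext fun j => ?_)
        by_cases hj : 1 ≤ j ∧ j ≤ min k n
        · rw [← (((hT c hc).1 a₁).mp h₁).2 j (Finset.mem_Icc.mpr hj),
            ← (((hT c' hc').1 a₂).mp h₂).2 j (Finset.mem_Icc.mpr hj)]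
          simpa only [appendRow_of_ne _ _ _ _ (show n ≠ n + 1 by omega)] using
            (congrFun (congrFun h n) j).symm
        · rw [((mem_rowsAbove hext1).mp hc).2.2 j hj, ((mem_rowsAbove hext1).mp hc').2.2 j hj]

end Trapezoids

section Translation

open MvPolynomial

@[to_additive]
lemma prod_Icc_succ_eq_prod_Ico {M : Type*} [CommMonoid M] (f : ℕ → M) (a n : ℕ) :
    ∏ i ∈ Finset.Icc (a + 1) n, f i = ∏ l ∈ Finset.Ico a n, f (l + 1) := by
  rw [Finset.prod_Ico_add' f a n 1]
  refine Finset.prod_congr ?_ fun _ _ => rfl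
  ext
  simp only [Finset.mem_Icc, Finset.mem_Ico]
  omega

lemma gogDeg_eq_mapDomain (n k : ℕ) :
    gogDeg n k = (∑ l ∈ Finset.range k, Finsupp.single l (n - 1) +
      ∑ l ∈ Finset.Ico k n, Finsupp.single l (n - 1 - (l - k))).mapDomain Nat.succ := by
  rw [Finsupp.mapDomain_add, Finsupp.mapDomain_finsetSum, Finsupp.mapDomain_finsetSum, gogDeg]
  simp only [Finsupp.mapDomain_single]
  rw [sum_Icc_succ_eq_sum_Ico _ 0 k, ← Finset.range_eq_Ico, sum_Icc_succ_eq_sum_Ico _ k n]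
  congr 1
  refine Finset.sum_congr rfl fun l hl => ?_
  have := Finset.mem_Ico.mp hl
  rw [show n + k - (l + 1) = n - 1 - (l - k) by omega]

lemma gogConstTerm_eq_coeff {A : Type*} [CommRing A] (Q : A) {m n k : ℕ} (hkn : k ≤ n)
    (b : ℕ → ℤ) :
    gogConstTerm Q m n k b = coeff (gogDeg n k)
      ((∏ i ∈ Finset.Icc 1 k, (1 + X i) ^ (b i).toNat) *
        (∏ i ∈ Finset.Icc (k + 1) n, (1 + C Q * X i) * (1 + X i) ^ (m + k)) *
        ∏ p ∈ (Finset.Icc 1 n ×ˢ Finset.Icc 1 n).filter (fun p => p.1 < p.2),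
          ((X p.1 - X p.2) * (1 + X p.2 + X p.1 * X p.2) : MvPolynomial ℕ A)) := by
  have hkernel : ∏ p ∈ (Finset.Icc 1 n ×ˢ Finset.Icc 1 n).filter (fun p => p.1 < p.2),
      ((X p.1 - X p.2) * (1 + X p.2 + X p.1 * X p.2) : MvPolynomial ℕ A) =
      rename Nat.succ (gogKernel A n) := by
    rw [gogKernel, pairProd_eq_prod_filter, Finset.prod_filter, Finset.prod_filter,
      Finset.prod_product, Finset.prod_product, map_prod, prod_Icc_succ_eq_prod_Ico _ 0 n,
      ← Finset.range_eq_Ico]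
    refine Finset.prod_congr rfl fun i _ => ?_
    rw [map_prod, prod_Icc_succ_eq_prod_Ico _ 0 n, ← Finset.range_eq_Ico]
    refine Finset.prod_congr rfl fun j _ => ?_
    simp only [add_lt_add_iff_right]
    split_ifs <;> simp
  have hexp : constExp n (n - 1) = ∑ l ∈ Finset.Ico k n, Finsupp.single l (l - k) +
      (∑ l ∈ Finset.range k, Finsupp.single l (n - 1) +
      ∑ l ∈ Finset.Ico k n, Finsupp.single l (n - 1 - (l - k))) := by
    rw [constExp, ← Finset.sum_range_add_sum_Ico _ hkn, add_left_comm, ← Finset.sum_add_distrib]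
    congr 1
    refine Finset.sum_congr rfl fun l hl => ?_
    have := Finset.mem_Ico.mp hl
    rw [← Finsupp.single_add, show l - k + (n - 1 - (l - k)) = n - 1 by omega]
  have hfac : ∏ l ∈ Finset.range n,
      Polynomial.aeval (X l : MvPolynomial ℕ A) (gogFactor Q m k b l) =
      monomial (∑ l ∈ Finset.Ico k n, Finsupp.single l (l - k)) 1 *
      ((∏ l ∈ Finset.range k, (1 + X l) ^ (b (l + 1)).toNat) *
        (∏ l ∈ Finset.Ico k n, (1 + C Q * X l) * (1 + X l) ^ (m + k))) := by
    rw [← Finset.prod_range_mul_prod_Ico _ hkn, monomial_sum_one, mul_left_comm,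
      ← Finset.prod_mul_distrib]
    congr 1
    · refine Finset.prod_congr rfl fun l hl => ?_
      rw [gogFactor, if_pos (Finset.mem_range.mp hl)]
      simp
    · refine Finset.prod_congr rfl fun l hl => ?_
      rw [gogFactor, if_neg (by have := Finset.mem_Ico.mp hl; omega), ← X_pow_eq_monomial]
      simp
      ring
  rw [gogConstTerm, gogCoeff_apply, hfac, hexp, mul_left_comm, coeff_monomial_mul, one_mul,
    ← coeff_rename_mapDomain _ Nat.succ_injective, ← gogDeg_eq_mapDomain, hkernel, mul_comm,
    prod_Icc_succ_eq_prod_Ico _ 0 k, ← Finset.range_eq_Ico, prod_Icc_succ_eq_prod_Ico _ k n]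
  simp [map_prod]

end Translation

/-- The generating function of `(m,n,k)`-Gog trapezoids with bottom row `(b_1,…,b_k)` w.r.t.
`Q^{#maxima not in the bottom row}` is the constant term of
`∏_{i=1}^k (1+x_i)^{b_i} x_i^{−n+1} ∏_{i=k+1}^n (1+Q x_i)(1+x_i)^{m+k} x_i^{−n+i−k}
 ∏_{1≤i<j≤n} (x_i−x_j)(1+x_j+x_i x_j)`,
an identity in `ℚ[Q]`. -/
theorem stmt9 (m n k : ℕ) (hk : 1 ≤ k) (hkn : k ≤ n) (b : ℕ → ℤ)
    (hb1 : 1 ≤ b 1) (hbk : b k ≤ (m : ℤ) + k)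
    (hbs : ∀ i, 1 ≤ i → i < k → b i < b (i+1)) :
    (∑ᶠ a ∈ {a : ℕ → ℕ → ℤ | IsGog m n k a ∧ ∀ j ∈ Finset.Icc 1 k, a n j = b j},
        (Polynomial.X : Polynomial ℚ) ^ gogMaxAbove m n k a) =
    MvPolynomial.coeff (gogDeg n k)
      ((∏ i ∈ Finset.Icc 1 k, (1 + MvPolynomial.X i) ^ (b i).toNat) *
        (∏ i ∈ Finset.Icc (k+1) n,
          (1 + MvPolynomial.C (Polynomial.X : Polynomial ℚ) * MvPolynomial.X i) *
            (1 + MvPolynomial.X i) ^ (m + k)) *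
        ∏ p ∈ (Finset.Icc 1 n ×ˢ Finset.Icc 1 n).filter (fun p => p.1 < p.2),
          ((MvPolynomial.X p.1 - MvPolynomial.X p.2) *
            (1 + MvPolynomial.X p.2 + MvPolynomial.X p.1 * MvPolynomial.X p.2) :
            MvPolynomial ℕ (Polynomial ℚ))) := by
  have hb : ∀ j, 1 ≤ j → j ≤ k → 1 ≤ b j ∧ b j ≤ m + j := by
    intro j hj hjk
    constructor
    · induction j, hj using Nat.le_induction with
      | base => exact hb1
      | succ j hj ih => exact (ih (by omega)).trans (hbs j hj hjk).le
    · induction hjk using Nat.decreasingInduction with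
      | self => exact hbk
      | of_succ j hjk ih =>
        have h := ih (by omega)
        have := hbs j hj hjk
        push_cast at h
        omega
  obtain ⟨S, hS, hsum⟩ := exists_finset_isGog_sum_eq (Polynomial.X : Polynomial ℚ) (m := m)
    hkn (fun _ => hk) hb hbs
  have hset : {a : ℕ → ℕ → ℤ | IsGog m n k a ∧ ∀ j ∈ Finset.Icc 1 k, a n j = b j} = ↑S :=
    Set.ext fun a => (hS a).symm
  rw [hset, finsum_mem_coe_finset, hsum, gogConstTerm_eq_coeff _ hkn]
end

section
/- Let m, n, k be non-negative integers with 1 ≤ k ≤ n, and let 1 ≤ b_{n−k+1} ≤ b_{n−k+2} ≤ … ≤ b_n be integers with b_i ≤ m+i for n−k+1 ≤ i ≤ n. Then Σ_B P^{p(B)} Q^{q(B)}, the sum over all (m,n,k)-Magog trapezoids B with bottom row (b_{n−k+1},…,b_n), where p(B) is the number of maxima of B and q(B) is the number of minima of B not located in the bottom row (i.e. minima b_{i,i−k+1} with i < n), equals the n×n determinant det_{1≤i,j≤n}(A_{i,j}), where for 1 ≤ i ≤ n−k: A_{i,j} = C(j+k+m−3, 2j+m−i−3) + (P+Q)·C(j+k+m−3,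 2j+m−i−2) + P·Q·C(j+k+m−3, 2j+m−i−1), and for n−k+1 ≤ i ≤ n: A_{i,j} = C(j+m+n−b_i−i−1, 2j+m−b_i−i−1) + P·C(j+m+n−b_i−i−1, 2j+m−b_i−i). This is an identity of polynomials in P and Q. -/
open scoped BigOperators Classical

/-- The coefficient ring `ℚ[P,Q]`. -/
abbrev T2 : Type := MvPolynomial (Fin 2) ℚ

/-- The indeterminate `P`. -/
noncomputable def Pv : T2 := MvPolynomial.X 0

/-- The indeterminate `Q`. -/
noncomputable def Qv : T2 := MvPolynomial.X 1

/-- The position `(i,j)` (row `i`, second index `j`, both 1-based) belongs to the shape of an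
`(m,n,k)`-Magog trapezoid: `1 ≤ i ≤ n` and `max(1, i−k+1) ≤ j ≤ i`. -/
def MagPos (n k i j : ℕ) : Prop := 1 ≤ i ∧ i ≤ n ∧ 1 ≤ j ∧ i + 1 ≤ j + k ∧ j ≤ i

/-- An `(m,n,k)`-Magog trapezoid, encoded as `B : ℕ → ℕ → ℤ` (zero off the shape): positive
entries, weak increase along NE- and SE-diagonals, and the entries of the `j`-th NE-diagonal
bounded above by `m+j`. -/
def IsMagog (m n k : ℕ) (B : ℕ → ℕ → ℤ) : Prop :=
  (∀ i j, MagPos n k i j → 1 ≤ B i j ∧ B i j ≤ (m : ℤ) + j) ∧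
  (∀ i j, MagPos n k i j → MagPos n k (i+1) j → B (i+1) j ≤ B i j) ∧
  (∀ i j, MagPos n k i j → MagPos n k (i+1) (j+1) → B i j ≤ B (i+1) (j+1)) ∧
  (∀ i j, ¬ MagPos n k i j → B i j = 0)

/-- The number of minima of a Magog trapezoid: entries `B_{i,i−k+1} = 1` of the leftmost
SE-diagonal. -/
noncomputable def magMin (n k : ℕ) (B : ℕ → ℕ → ℤ) : ℕ :=
  ((Finset.Icc k n).filter (fun i => B i (i + 1 - k) = 1)).card

/-- The number of maxima of a Magog trapezoid: entries `B_{i,i} = m+i` of the rightmost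
SE-diagonal. -/
noncomputable def magMax (m n : ℕ) (B : ℕ → ℕ → ℤ) : ℕ :=
  ((Finset.Icc 1 n).filter (fun i => B i i = (m : ℤ) + i)).card

/-- The number of minima not located in the bottom row. -/
noncomputable def magMinAbove (n k : ℕ) (B : ℕ → ℕ → ℤ) : ℕ :=
  ((Finset.Icc k n).filter (fun i => i < n ∧ B i (i + 1 - k) = 1)).card

/-- The generalized binomial coefficient `C(a,r) = a(a−1)⋯(a−r+1)/r!` for integers `a, r`,
with `C(a,r) = 0` for `r < 0`. -/
noncomputable def qchoose (a r : ℤ) : ℚ :=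
  if 0 ≤ r then (∏ t ∈ Finset.range r.toNat, ((a : ℚ) - t)) / (r.toNat).factorial else 0

/-- The Pascal recurrence for the generalized binomial coefficient, at all integers. -/
theorem qchoose_add_one (a r : ℤ) :
    qchoose (a + 1) (r + 1) = qchoose a r + qchoose a (r + 1) := by
  rcases lt_trichotomy r (-1) with h | h | h
  · simp [qchoose, show ¬ (0 ≤ r + 1) by omega, show ¬ (0 ≤ r) by omega]
  · subst h
    simp [qchoose]
  · obtain ⟨s, rfl⟩ := Int.eq_ofNat_of_zero_le (show 0 ≤ r by omega)
    have h1 : ((s : ℤ) + 1).toNat = s + 1 := by omega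
    have h2 : (0 : ℤ) ≤ (s : ℤ) + 1 := by omega
    have h3 : (0 : ℤ) ≤ (s : ℤ) := by omega
    simp only [qchoose, h1, h2, h3, if_true, Int.toNat_natCast]
    rw [Finset.prod_range_succ', Finset.prod_range_succ, Nat.factorial_succ]
    have h4 : ∀ t : ℕ, ((a + 1 : ℤ) : ℚ) - ((t + 1 : ℕ) : ℚ) = a - t := by
      intro t; push_cast; ring
    simp only [h4]
    have h5 : (s.factorial : ℚ) ≠ 0 := by exact_mod_cast s.factorial_ne_zero
    have h6 : (s : ℚ) + 1 ≠ 0 := by positivity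
    push_cast
    field_simp
    ring

theorem qchoose_of_neg {a r : ℤ} (h : r < 0) : qchoose a r = 0 := by
  simp [qchoose, show ¬ (0 ≤ r) by omega]

theorem qchoose_eq_choose (a r : ℕ) : qchoose a r = (a.choose r : ℚ) := by
  induction a generalizing r with
  | zero =>
    cases r with
    | zero => simp [qchoose]
    | succ r =>
      simp only [qchoose, Nat.choose_zero_succ]
      rw [if_pos (by omega), Int.toNat_natCast, Finset.prod_eq_zero (i := 0) (by simp) (by simp)]
      simp
  | succ a ih =>
    cases r with
    | zero => simp [qchoose]
    | succ r =>
      push_cast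
      rw [qchoose_add_one, Nat.choose_succ_succ, ih, ← Nat.cast_succ, ih]
      push_cast
      ring

theorem qchoose_self {a : ℤ} (h : 0 ≤ a) : qchoose a a = 1 := by
  lift a to ℕ using h
  simp [qchoose_eq_choose]

theorem qchoose_of_lt {a r : ℤ} (h : 0 ≤ a) (hr : a < r) : qchoose a r = 0 := by
  lift a to ℕ using h
  lift r to ℕ using by omega
  rw [qchoose_eq_choose, Nat.choose_eq_zero_of_lt (by omega), Nat.cast_zero]

/-- The (0-based) entry `(i,j)` of the determinant in one of the first `n - k` rows. -/
noncomputable def upEntry (m k i j : ℕ) : T2 :=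
  MvPolynomial.C (qchoose ((j : ℤ) + 1 + k + m - 3) (2 * ((j : ℤ) + 1) + m - ((i : ℤ) + 1) - 3)) +
    (Pv + Qv) *
      MvPolynomial.C (qchoose ((j : ℤ) + 1 + k + m - 3) (2 * ((j : ℤ) + 1) + m - ((i : ℤ) + 1) - 2)) +
    Pv * Qv *
      MvPolynomial.C (qchoose ((j : ℤ) + 1 + k + m - 3) (2 * ((j : ℤ) + 1) + m - ((i : ℤ) + 1) - 1))

/-- The (0-based) entry `(i,j)` of the determinant in one of the last `k` rows, as a function of
the entry `y` of the bottom row. -/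
noncomputable def lowEntry (m n i j : ℕ) (y : ℤ) : T2 :=
  MvPolynomial.C (qchoose ((j : ℤ) + 1 + m + n - y - ((i : ℤ) + 1) - 1)
      (2 * ((j : ℤ) + 1) + m - y - ((i : ℤ) + 1) - 1)) +
    Pv * MvPolynomial.C (qchoose ((j : ℤ) + 1 + m + n - y - ((i : ℤ) + 1) - 1)
      (2 * ((j : ℤ) + 1) + m - y - ((i : ℤ) + 1)))

/-- The (0-based) entry `(i,j)` of the determinant. -/
noncomputable def detEntry (m n k i j : ℕ) (y : ℤ) : T2 :=
  if i + 1 ≤ n - k then upEntry m k i j else lowEntry m n i j y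

theorem lowEntry_add_one (m n i j : ℕ) (y : ℤ) :
    lowEntry m n i j (y + 1) = lowEntry m n (i + 1) j y := by
  unfold lowEntry
  push_cast
  congr 4 <;> ring_nf

theorem lowEntry_eq_add (m n i j : ℕ) (y : ℤ) :
    lowEntry m (n + 1) i j y = lowEntry m n i j y + lowEntry m (n + 1) i j (y + 1) := by
  have h := qchoose_add_one ((j : ℤ) + 1 + m + n - y - ((i : ℤ) + 1) - 1)
    (2 * ((j : ℤ) + 1) + m - y - ((i : ℤ) + 1) - 1 - 1)
  have h' := qchoose_add_one ((j : ℤ) + 1 + m + n - y - ((i : ℤ) + 1) - 1)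
    (2 * ((j : ℤ) + 1) + m - y - ((i : ℤ) + 1) - 1)
  simp only [sub_add_cancel] at h h'
  have e1 : (j : ℤ) + 1 + m + n - y - ((i : ℤ) + 1)
      = (j : ℤ) + 1 + m + (n + 1 : ℕ) - y - ((i : ℤ) + 1) - 1 := by push_cast; ring
  have e2 : (j : ℤ) + 1 + m + n - y - ((i : ℤ) + 1) - 1
      = (j : ℤ) + 1 + m + (n + 1 : ℕ) - (y + 1) - ((i : ℤ) + 1) - 1 := by push_cast; ring
  have e3 : 2 * ((j : ℤ) + 1) + m - y - ((i : ℤ) + 1) - 1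
      = 2 * ((j : ℤ) + 1) + m - (y + 1) - ((i : ℤ) + 1) := by ring
  unfold lowEntry
  rw [← e1, ← e2, ← e3, h, h']
  simp only [MvPolynomial.C_add]
  ring

theorem sum_lowEntry (m n i j : ℕ) (lo hi : ℤ) (h : lo ≤ hi + 1) :
    ∑ y ∈ Finset.Icc lo hi, lowEntry m n i j y
      = lowEntry m (n + 1) i j lo - lowEntry m (n + 1) (i + 1) j hi := by
  obtain ⟨d, hd⟩ := Int.eq_ofNat_of_zero_le (show 0 ≤ hi + 1 - lo by omega)
  obtain rfl : hi = lo + d - 1 := by omega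
  clear hd h
  induction d with
  | zero =>
    rw [Finset.Icc_eq_empty (by simp), ← lowEntry_add_one]
    simp
  | succ d ih =>
    have : Finset.Icc lo (lo + ((d + 1 : ℕ) : ℤ) - 1)
        = insert (lo + d) (Finset.Icc lo (lo + (d : ℤ) - 1)) := by
      ext t; simp only [Finset.mem_Icc, Finset.mem_insert]; push_cast; omega
    rw [this, Finset.sum_insert (by simp), ih, ← lowEntry_add_one, ← lowEntry_add_one,
      sub_add_cancel, lowEntry_eq_add m n i j (lo + d)]
    push_cast
    rw [show lo + ((d : ℤ) + 1) - 1 + 1 = lo + d + 1 by ring]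
    ring

theorem upEntry_eq (m n k i j : ℕ) (h : i + k = n) :
    upEntry m k i j = Qv * lowEntry m n i j 1 + lowEntry m (n + 1) i j 2 := by
  subst h
  have e1 : (j : ℤ) + 1 + m + (i + k : ℕ) - 1 - ((i : ℤ) + 1) - 1
      = (j : ℤ) + 1 + k + m - 3 := by push_cast; ring
  have e2 : (j : ℤ) + 1 + m + (i + k + 1 : ℕ) - 2 - ((i : ℤ) + 1) - 1
      = (j : ℤ) + 1 + k + m - 3 := by push_cast; ring
  have e3 : 2 * ((j : ℤ) + 1) + m - 1 - ((i : ℤ) + 1) - 1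
      = 2 * ((j : ℤ) + 1) + m - ((i : ℤ) + 1) - 2 := by ring
  have e4 : 2 * ((j : ℤ) + 1) + m - 1 - ((i : ℤ) + 1)
      = 2 * ((j : ℤ) + 1) + m - ((i : ℤ) + 1) - 1 := by ring
  have e5 : 2 * ((j : ℤ) + 1) + m - 2 - ((i : ℤ) + 1) - 1
      = 2 * ((j : ℤ) + 1) + m - ((i : ℤ) + 1) - 3 := by ring
  have e6 : 2 * ((j : ℤ) + 1) + m - 2 - ((i : ℤ) + 1)
      = 2 * ((j : ℤ) + 1) + m - ((i : ℤ) + 1) - 2 := by ring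
  unfold upEntry lowEntry
  rw [e1, e2, e3, e4, e5, e6]
  ring

theorem lowEntry_eq_zero (m n i j : ℕ) (y : ℤ) (h : (m : ℤ) + 2 * j + 1 < y + i) :
    lowEntry m n i j y = 0 := by
  unfold lowEntry
  rw [qchoose_of_neg (by omega), qchoose_of_neg (by omega)]
  simp

theorem lowEntry_last (m n i : ℕ) (y : ℤ) (h : y + i ≤ (m : ℤ) + 2 * n) :
    lowEntry m (n + 1) i n y = 1 := by
  have e : 2 * ((n : ℤ) + 1) + m - y - ((i : ℤ) + 1) - 1
      = (n : ℤ) + 1 + m + (n + 1 : ℕ) - y - ((i : ℤ) + 1) - 1 := by push_cast; ring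
  unfold lowEntry
  rw [e, qchoose_self (by push_cast; omega),
    qchoose_of_lt (by push_cast; omega) (by push_cast; omega)]
  simp

theorem lowEntry_last_max (m n : ℕ) :
    lowEntry m (n + 1) n n ((m : ℤ) + n + 1) = Pv := by
  have e : 2 * ((n : ℤ) + 1) + m - ((m : ℤ) + n + 1) - ((n : ℤ) + 1) = 0 := by ring
  unfold lowEntry
  rw [e, qchoose_of_neg (by omega)]
  simp [qchoose]

theorem upEntry_last (m n k i : ℕ) (hk : 1 ≤ k) (h : i + k ≤ n) :
    upEntry m k i n = if i + k < n then 0 else 1 := by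
  unfold upEntry
  split_ifs with h'
  · rw [qchoose_of_lt (by omega) (by omega), qchoose_of_lt (by omega) (by omega),
      qchoose_of_lt (by omega) (by omega)]
    simp
  · have e : 2 * ((n : ℤ) + 1) + m - ((i : ℤ) + 1) - 3 = (n : ℤ) + 1 + k + m - 3 := by omega
    rw [e, qchoose_self (by omega), qchoose_of_lt (by omega) (by omega),
      qchoose_of_lt (by omega) (by omega)]
    simp

theorem det_eq_zero_of_corner {n : ℕ} {R : Type*} [CommRing R] (M : Matrix (Fin n) (Fin n) R)
    (a : Fin n) (h : ∀ i j, a ≤ i → j ≤ a → M i j = 0) : M.det = 0 := by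
  rw [Matrix.det_apply]
  refine Finset.sum_eq_zero fun σ _ => ?_
  obtain ⟨j, hj, hσ⟩ : ∃ j, j ≤ a ∧ a ≤ σ j := by
    by_contra! hcon
    have h1 : (Finset.Iic a).image σ ⊆ Finset.Iio a := by
      intro t ht
      obtain ⟨j, hj, rfl⟩ := Finset.mem_image.1 ht
      exact Finset.mem_Iio.2 (hcon j (Finset.mem_Iic.1 hj))
    have h2 := Finset.card_le_card h1
    rw [Finset.card_image_of_injective _ σ.injective, Fin.card_Iic, Fin.card_Iio] at h2
    omega
  rw [Finset.prod_eq_zero (f := fun i => M (σ i) i) (Finset.mem_univ j) (h _ _ hσ hj), smul_zero]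

theorem det_eq_det_sub_succ {n : ℕ} {R : Type*} [CommRing R]
    (N : Matrix (Fin (n + 1)) (Fin (n + 1)) R) (e : Fin n → R)
    (hcol : ∀ i : Fin n, N i.castSucc (Fin.last n) = e i * N i.succ (Fin.last n))
    (hlast : N (Fin.last n) (Fin.last n) = 1) :
    N.det = (Matrix.of fun i j : Fin n =>
      N i.castSucc j.castSucc - e i * N i.succ j.castSucc).det := by
  let B : Matrix (Fin (n + 1)) (Fin (n + 1)) R := Matrix.of <|
    Fin.snoc (α := fun _ => Fin (n + 1) → R)
      (fun i j => N i.castSucc j - e i * N i.succ j) (N (Fin.last n))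
  have hB : N.det = B.det := by
    rw [← Matrix.det_submatrix_equiv_self Fin.revPerm N,
      ← Matrix.det_submatrix_equiv_self Fin.revPerm B]
    refine Matrix.det_eq_of_forall_row_eq_smul_add_pred (fun i => e i.rev) ?_ ?_
    · intro j
      simp [B]
    · intro i j
      simp [B, Fin.rev_succ, Fin.rev_castSucc]
  rw [hB, Matrix.det_succ_column B (Fin.last n),
    Finset.sum_eq_single (Fin.last n)]
  · simp [B, hlast, ← two_mul, pow_mul]
    congr 1
    ext i j
    simp
  · intro i _ hi
    obtain ⟨i, rfl⟩ := Fin.exists_castSucc_eq.2 hi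
    simp [B, hcol]
  · simp

/-- Conditions on a bottom row `(c_{n-k+1},…,c_n)`: positivity, monotonicity and upper bounds. -/
structure IsBottomRow (m n k : ℕ) (c : ℕ → ℤ) : Prop where
  pos : ∀ i, n - k + 1 ≤ i → i ≤ n → 1 ≤ c i
  mono : ∀ i, n - k + 1 ≤ i → i < n → c i ≤ c (i + 1)
  le : ∀ i, n - k + 1 ≤ i → i ≤ n → c i ≤ (m : ℤ) + i

/-- The matrix whose determinant counts trapezoids with bottom row `c`. -/
noncomputable def magogMatrix (m n k : ℕ) (c : ℕ → ℤ) : Matrix (Fin n) (Fin n) T2 :=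
  Matrix.of fun i j => detEntry m n k i j (c (i + 1))

/-- The interval of the values that interlacing with a bottom row `c` of length `n + 1` allows at
position `i + 1` of the row above it. -/
noncomputable def interlaceRange (n k : ℕ) (c : ℕ → ℤ) (i : Fin n) : Finset ℤ :=
  if i + k < n then {0}
  else Finset.Icc (if i + k = n then 1 else c (i + 1)) (c (i + 2))

/-- The values in `interlaceRange` which also respect the bound on the entries. -/
noncomputable def cappedRange (m n k : ℕ) (c : ℕ → ℤ) (i : Fin n) : Finset ℤ :=
  (interlaceRange n k c i).filter (· ≤ (m : ℤ) + i + 1)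

/-- The weight contributed by an entry `y` at position `i + 1` of row `n`. -/
noncomputable def minWeight (n k i : ℕ) (y : ℤ) : T2 :=
  if i + k = n ∧ y = 1 then Qv else 1

/-- The weight contributed by the last entry of the bottom row. -/
noncomputable def maxWeight (m n : ℕ) (y : ℤ) : T2 :=
  if y = (m : ℤ) + n then Pv else 1

/-- A row of length `n` as a function on `ℕ`, with 1-based indices. -/
def extRow {n : ℕ} (r : Fin n → ℤ) (j : ℕ) : ℤ :=
  if h : 1 ≤ j ∧ j ≤ n then r ⟨j - 1, by omega⟩ else 0

@[simp] theorem extRow_succ {n : ℕ} (r : Fin n → ℤ) (i : Fin n) : extRow r (i + 1) = r i := by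
  simp [extRow, show (i : ℕ) + 1 ≤ n from i.2]

theorem extRow_of_lt {n : ℕ} (r : Fin n → ℤ) (i : ℕ) (h : i < n) :
    extRow r (i + 1) = r ⟨i, h⟩ :=
  extRow_succ r ⟨i, h⟩

theorem sum_minWeight_mul_detEntry {m n k : ℕ} {c : ℕ → ℤ} (hc : IsBottomRow m (n + 1) k c)
    (i : Fin n) (j : ℕ) :
    ∑ y ∈ interlaceRange n k c i, minWeight n k i y * detEntry m n k i j y =
      detEntry m (n + 1) k i j (c (i + 1)) -
        (if (i : ℕ) + k < n then 0 else 1) * lowEntry m (n + 1) (i + 1) j (c (i + 2)) := by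
  have hi := i.2
  unfold interlaceRange detEntry minWeight
  rcases lt_trichotomy ((i : ℕ) + k) n with h | h | h
  · simp [h, h.ne, show (i : ℕ) + 1 ≤ n - k by omega, show (i : ℕ) + 1 ≤ n + 1 - k by omega]
  · have h1 : 1 ≤ c (i + 2) := hc.pos _ (by omega) (by omega)
    have h2 : Finset.Icc (1 : ℤ) (c (i + 2)) = insert 1 (Finset.Icc 2 (c (i + 2))) := by
      ext t; simp only [Finset.mem_Icc, Finset.mem_insert]; omega
    have h3 : ∑ y ∈ Finset.Icc (2 : ℤ) (c (i + 2)), (if y = 1 then Qv else 1) * lowEntry m n i j y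
        = ∑ y ∈ Finset.Icc (2 : ℤ) (c (i + 2)), lowEntry m n i j y := by
      refine Finset.sum_congr rfl fun y hy => ?_
      have := (Finset.mem_Icc.1 hy).1
      rw [if_neg (by omega), one_mul]
    simp only [h, lt_irrefl, if_false, if_true, true_and,
      show ¬ ((i : ℕ) + 1 ≤ n - k) by omega, show (i : ℕ) + 1 ≤ n + 1 - k by omega]
    rw [h2, Finset.sum_insert (by simp), h3, sum_lowEntry _ _ _ _ _ _ (by omega),
      upEntry_eq m n k i j h]
    simp only [if_true]
    ring
  · simp only [show ¬ ((i : ℕ) + k < n) by omega, h.ne', if_false, false_and,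
      show ¬ ((i : ℕ) + 1 ≤ n - k) by omega, show ¬ ((i : ℕ) + 1 ≤ n + 1 - k) by omega, one_mul]
    have := hc.mono (i + 1) (by omega) (by omega)
    exact sum_lowEntry _ _ _ _ _ _ (by rw [add_assoc (i : ℕ)] at this; norm_num at this; omega)

theorem det_magogMatrix_eq_zero {m n k : ℕ} {c : ℕ → ℤ} (r : Fin n → ℤ)
    (hr : ∀ i, r i ∈ interlaceRange n k c i) (a : Fin n) (ha : (m : ℤ) + a + 1 < r a) :
    (magogMatrix m n k (extRow r)).det = 0 := by
  have hak : ¬ ((a : ℕ) + k < n) := by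
    intro h
    have := hr a
    simp [interlaceRange, h] at this
    omega
  have hle : ∀ d : ℕ, ∀ h : (a : ℕ) + d < n, r a ≤ r ⟨a + d, h⟩ := by
    intro d
    induction d with
    | zero => intro h; rfl
    | succ d ih =>
      intro h
      refine (ih (by omega)).trans ?_
      have h1 := hr ⟨a + d, by omega⟩
      have h2 := hr ⟨a + (d + 1), h⟩
      simp only [interlaceRange] at h1 h2
      rw [if_neg (by omega)] at h1 h2
      rw [Finset.mem_Icc, if_neg (by omega)] at h2
      exact (Finset.mem_Icc.1 h1).2.trans h2.1
  refine det_eq_zero_of_corner _ a fun i j hai hja => ?_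
  have hai' : (a : ℕ) ≤ i := hai
  have hja' : (j : ℕ) ≤ a := hja
  have h1 := hle (i - a) (by omega)
  have h2 : (⟨a + (i - a), by omega⟩ : Fin n) = i := by ext; simp; omega
  rw [h2] at h1
  simp only [magogMatrix, detEntry, Matrix.of_apply, extRow_succ]
  rw [if_neg (by omega), lowEntry_eq_zero _ _ _ _ _ (by omega)]

theorem det_magogMatrix_succ {m n k : ℕ} (hk : 1 ≤ k) {c : ℕ → ℤ}
    (hc : IsBottomRow m (n + 1) k c) :
    (magogMatrix m (n + 1) k c).det = maxWeight m (n + 1) (c (n + 1)) *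
      ∑ r ∈ Fintype.piFinset (cappedRange m n k c),
        (∏ i : Fin n, minWeight n k i (r i)) * (magogMatrix m n k (extRow r)).det := by
  have hsub : Fintype.piFinset (cappedRange m n k c) ⊆ Fintype.piFinset (interlaceRange n k c) :=
    Fintype.piFinset_subset _ _ fun i => Finset.filter_subset _ _
  rw [Finset.sum_subset hsub]
  swap
  · intro r hr hr'
    rw [Fintype.mem_piFinset] at hr hr'
    push Not at hr'
    obtain ⟨a, ha⟩ := hr'
    rw [det_magogMatrix_eq_zero r hr a, mul_zero]
    by_contra hcon
    exact ha (Finset.mem_filter.2 ⟨hr a, not_lt.1 hcon⟩)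
  have hsum : ∑ r ∈ Fintype.piFinset (interlaceRange n k c),
        (∏ i : Fin n, minWeight n k i (r i)) * (magogMatrix m n k (extRow r)).det =
      (Matrix.of fun i j : Fin n =>
        ∑ y ∈ interlaceRange n k c i, minWeight n k i y * detEntry m n k i j y).det := by
    have := (Matrix.detRowAlternating (n := Fin n) (R := T2)).toMultilinearMap.map_sum_finset
      (fun (i : Fin n) (y : ℤ) (j : Fin n) => minWeight n k i y * detEntry m n k i j y)
      (interlaceRange n k c)
    have e : (Matrix.of fun i j : Fin n =>
        ∑ y ∈ interlaceRange n k c i, minWeight n k i y * detEntry m n k i j y) =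
        fun i => ∑ y ∈ interlaceRange n k c i,
          fun j : Fin n => minWeight n k i y * detEntry m n k i j y := by
      ext i j : 1
      simp [Finset.sum_apply]
    rw [e]
    refine Eq.trans ?_ this.symm
    refine Finset.sum_congr rfl fun r _ => ?_
    rw [← Matrix.det_mul_column]
    simp only [magogMatrix, Matrix.of_apply, extRow_succ]
    rfl
  rw [hsum]
  let N : Matrix (Fin (n + 1)) (Fin (n + 1)) T2 := Matrix.of fun i j =>
    if i = Fin.last n ∧ c (n + 1) = (m : ℤ) + (n + 1 : ℕ) then (if j = Fin.last n then 1 else 0)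
    else detEntry m (n + 1) k i j (c (i + 1))
  have hNlast : ∀ j, N (Fin.last n) (Fin.castSucc j) = lowEntry m (n + 1) n j (c (n + 1)) := by
    intro j
    have hj := j.2
    simp only [N, Matrix.of_apply, true_and]
    split_ifs with h1 h2
    · exact absurd h2 (Fin.castSucc_lt_last j).ne
    · rw [lowEntry_eq_zero _ _ _ _ _ (by push_cast at h1; omega)]
    · simp only [detEntry, Fin.val_last, Fin.val_castSucc]
      rw [if_neg (by omega)]
  have hN : (magogMatrix m (n + 1) k c).det = maxWeight m (n + 1) (c (n + 1)) * N.det := by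
    have := Matrix.det_mul_column
      (fun i : Fin (n + 1) => if i = Fin.last n then maxWeight m (n + 1) (c (n + 1)) else 1) N
    rw [Finset.prod_ite_eq' Finset.univ (Fin.last n), if_pos (Finset.mem_univ _)] at this
    rw [← this]
    congr 1
    ext i j : 1
    by_cases hi : i = Fin.last n
    · subst hi
      by_cases hcm : c (n + 1) = (m : ℤ) + (n + 1 : ℕ)
      · have hcm' : c (n + 1) = (m : ℤ) + n + 1 := by rw [hcm]; push_cast; ring
        simp only [magogMatrix, N, Matrix.of_apply, maxWeight, hcm, detEntry, if_true, true_and,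
          Fin.val_last]
        rw [if_neg (by omega), ← hcm, hcm']
        split_ifs with hj
        · subst hj
          rw [Fin.val_last, lowEntry_last_max, mul_one]
        · have := Fin.val_lt_last hj
          rw [lowEntry_eq_zero _ _ _ _ _ (by omega), mul_zero]
      · simp only [magogMatrix, N, maxWeight, Matrix.of_apply, if_true, hcm, and_false, if_false,
          one_mul]
    · simp [magogMatrix, N, hi]
  rw [hN]
  congr 1
  have hNcast : ∀ (i : Fin n) j, N i.castSucc j = detEntry m (n + 1) k i j (c (i + 1)) := by
    intro i j
    simp [N, (Fin.castSucc_lt_last i).ne]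
  have hlast : N (Fin.last n) (Fin.last n) = 1 := by
    simp only [N, Matrix.of_apply, true_and, if_true]
    split_ifs with h1
    · rfl
    · have := hc.le (n + 1) (by omega) le_rfl
      simp only [detEntry, Fin.val_last]
      rw [if_neg (by omega), lowEntry_last _ _ _ _ (by push_cast at *; omega)]
  have hlow : ∀ i : Fin n, ¬ ((i : ℕ) + k < n) → N i.castSucc (Fin.last n) = 1 := by
    intro i hi
    have := i.2
    rw [hNcast, detEntry, Fin.val_last]
    split_ifs with h1
    · rw [upEntry_last _ _ _ _ hk (by omega), if_neg hi]
    · have := hc.le (i + 1) (by omega) (by omega)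
      rw [lowEntry_last _ _ _ _ (by push_cast at *; omega)]
  rw [det_eq_det_sub_succ N (fun i => if (i : ℕ) + k < n then 0 else 1) _ hlast]
  · congr 1
    ext i j : 1
    simp only [Matrix.of_apply]
    rw [sum_minWeight_mul_detEntry hc, hNcast, Fin.val_castSucc]
    by_cases hi : (i : ℕ) + k < n
    · simp [hi]
    · simp only [hi, if_false, one_mul]
      congr 1
      rcases Fin.eq_castSucc_or_eq_last i.succ with ⟨t, ht⟩ | ht
      · have hti : (t : ℕ) = i + 1 := by
          have := congrArg Fin.val ht
          simpa using this.symm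
        rw [ht, hNcast, hti, Fin.val_castSucc, detEntry, if_neg (by omega)]
      · have hti : (i : ℕ) + 1 = n := by
          have := congrArg Fin.val ht
          simpa using this
        rw [ht, hNlast, show (i : ℕ) + 2 = n + 1 by omega, hti]
  · intro i
    by_cases hi : (i : ℕ) + k < n
    · rw [if_pos hi, zero_mul, hNcast, detEntry, if_pos (by omega), Fin.val_last,
        upEntry_last _ _ _ _ hk (by omega), if_pos hi]
    · rw [if_neg hi, one_mul, hlow i hi]
      rcases Fin.eq_castSucc_or_eq_last i.succ with ⟨t, ht⟩ | ht
      · have hti : (t : ℕ) = i + 1 := by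
          have := congrArg Fin.val ht
          simpa using this.symm
        rw [ht, hlow t (by omega)]
      · rw [ht, hlast]

/-- The set of `(m,n,k)`-Magog trapezoids with bottom row `c`. -/
def magogSet (m n k : ℕ) (c : ℕ → ℤ) : Set (ℕ → ℕ → ℤ) :=
  {B | IsMagog m n k B ∧ ∀ j ∈ Finset.Icc (n - k + 1) n, B n j = c j}

/-- The array obtained from an array with `n` rows by adding the bottom row `c`. -/
noncomputable def addRow (n k : ℕ) (c : ℕ → ℤ) (B : ℕ → ℕ → ℤ) (i j : ℕ) : ℤ :=
  if i = n + 1 then (if MagPos (n + 1) k (n + 1) j then c j else 0) else B i j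

theorem addRow_of_ne {n k : ℕ} {c : ℕ → ℤ} {B : ℕ → ℕ → ℤ} {i : ℕ} (h : i ≠ n + 1) (j : ℕ) :
    addRow n k c B i j = B i j := by
  simp [addRow, h]

theorem addRow_last {n k : ℕ} {c : ℕ → ℤ} {B : ℕ → ℕ → ℤ} {j : ℕ}
    (h : MagPos (n + 1) k (n + 1) j) : addRow n k c B (n + 1) j = c j := by
  simp [addRow, h]

theorem isBottomRow_extRow {m n k : ℕ} {c : ℕ → ℤ} (hc : IsBottomRow m (n + 1) k c)
    {r : Fin n → ℤ} (hr : r ∈ Fintype.piFinset (cappedRange m n k c)) :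
    IsBottomRow m n k (extRow r) := by
  simp only [Fintype.mem_piFinset, cappedRange, interlaceRange, Finset.mem_filter] at hr
  refine ⟨fun i hi hin => ?_, fun i hi hin => ?_, fun i hi hin => ?_⟩
  · obtain ⟨i, rfl⟩ : ∃ t, i = t + 1 := ⟨i - 1, by omega⟩
    have h1 := (hr ⟨i, by omega⟩).1
    rw [if_neg (by simp only; omega), Finset.mem_Icc] at h1
    rw [extRow_of_lt r i (by omega)]
    refine le_trans ?_ h1.1
    split_ifs with h2
    · rfl
    · exact hc.pos _ (by simp only at *; omega) (by simp only; omega)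
  · obtain ⟨i, rfl⟩ : ∃ t, i = t + 1 := ⟨i - 1, by omega⟩
    have h1 := (hr ⟨i, by omega⟩).1
    have h2 := (hr ⟨i + 1, by omega⟩).1
    rw [if_neg (by simp only; omega), Finset.mem_Icc] at h1 h2
    rw [if_neg (by simp only; omega)] at h2
    rw [extRow_of_lt r i (by omega), extRow_of_lt r (i + 1) (by omega)]
    exact h1.2.trans h2.1
  · obtain ⟨i, rfl⟩ : ∃ t, i = t + 1 := ⟨i - 1, by omega⟩
    have h1 := (hr ⟨i, by omega⟩).2
    rw [extRow_of_lt r i (by omega)]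
    push_cast
    simp only at h1
    omega

theorem magogSet_zero (m k : ℕ) (c : ℕ → ℤ) : magogSet m 0 k c = {fun _ _ => 0} := by
  have h : ∀ i j, ¬ MagPos 0 k i j := fun i j h => by unfold MagPos at h; omega
  ext B
  simp only [magogSet, IsMagog, Set.mem_ofPred_eq, Set.mem_singleton_iff]
  constructor
  · rintro ⟨⟨_, _, _, h0⟩, _⟩
    funext i j
    exact h0 i j (h i j)
  · rintro rfl
    refine ⟨⟨fun i j hp => absurd hp (h i j), fun i j hp => absurd hp (h i j),
      fun i j hp => absurd hp (h i j), fun _ _ _ => rfl⟩, fun j hj => ?_⟩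
    rw [Finset.mem_Icc] at hj
    omega

theorem magogSet_succ {m n k : ℕ} {c : ℕ → ℤ} (hc : IsBottomRow m (n + 1) k c) :
    magogSet m (n + 1) k c = addRow n k c ''
      ⋃ r ∈ (Fintype.piFinset (cappedRange m n k c) : Set (Fin n → ℤ)),
        magogSet m n k (extRow r) := by
  ext B
  simp only [Set.mem_image, Set.mem_iUnion, exists_prop, Finset.mem_coe, Fintype.mem_piFinset]
  constructor
  · rintro ⟨⟨hB1, hB2, hB3, hB4⟩, hBc⟩
    have hrow : ∀ j, MagPos (n + 1) k (n + 1) j → B (n + 1) j = c j := by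
      intro j hj
      unfold MagPos at hj
      exact hBc j (Finset.mem_Icc.2 (by omega))
    refine ⟨fun i j => if i = n + 1 then 0 else B i j, ⟨fun i => B n (i + 1), ?_, ?_, ?_⟩, ?_⟩
    · intro i
      have hi := i.2
      simp only [cappedRange, interlaceRange, Finset.mem_filter]
      by_cases h : (i : ℕ) + k < n
      · have h0 : B n (i + 1) = 0 := hB4 _ _ (by unfold MagPos; omega)
        rw [if_pos h, h0]
        exact ⟨Finset.mem_singleton_self _, by positivity⟩
      · rw [if_neg h, Finset.mem_Icc]
        have hp : MagPos (n + 1) k n (i + 1) := by unfold MagPos; omega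
        have h1 := hB1 _ _ hp
        have hp3 : MagPos (n + 1) k (n + 1) (i + 1 + 1) := by unfold MagPos; omega
        have h3 := hB3 _ _ hp hp3
        rw [hrow _ hp3] at h3
        refine ⟨⟨?_, h3⟩, by push_cast at h1; omega⟩
        split_ifs with h'
        · exact h1.1
        · have hp2 : MagPos (n + 1) k (n + 1) (i + 1) := by unfold MagPos; omega
          have h2 := hB2 _ _ hp hp2
          rwa [hrow _ hp2] at h2
    · have hmp : ∀ i j, MagPos n k i j → MagPos (n + 1) k i j ∧ i ≠ n + 1 := by
        unfold MagPos; intros; omega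
      refine ⟨fun i j hp => ?_, fun i j hp hp' => ?_, fun i j hp hp' => ?_, fun i j hp => ?_⟩
      · simp only [if_neg (hmp i j hp).2]
        exact hB1 i j (hmp i j hp).1
      · simp only [if_neg (hmp i j hp).2, if_neg (hmp _ _ hp').2]
        exact hB2 i j (hmp i j hp).1 (hmp _ _ hp').1
      · simp only [if_neg (hmp i j hp).2, if_neg (hmp _ _ hp').2]
        exact hB3 i j (hmp i j hp).1 (hmp _ _ hp').1
      · simp only
        split_ifs with h
        · rfl
        · exact hB4 i j (by unfold MagPos at *; omega)
    · intro j hj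
      rw [Finset.mem_Icc] at hj
      obtain ⟨j, rfl⟩ : ∃ t, j = t + 1 := ⟨j - 1, by omega⟩
      rw [extRow_of_lt _ j (by omega)]
      simp
    · funext i j
      by_cases hi : i = n + 1
      · subst hi
        by_cases hj : MagPos (n + 1) k (n + 1) j
        · rw [addRow_last hj, hrow _ hj]
        · simp only [addRow, if_true, if_neg hj]
          exact (hB4 _ _ hj).symm
      · simp [addRow, hi]
  · rintro ⟨B, ⟨r, hr, ⟨⟨hB1, hB2, hB3, hB4⟩, hBr⟩⟩, rfl⟩
    have hrow : ∀ i : Fin n, n ≤ i + k → B n (i + 1) = r i := by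
      intro i hi
      rw [hBr _ (Finset.mem_Icc.2 (by omega)), extRow_succ]
    have hr' : ∀ i : Fin n, n ≤ i + k →
        (if (i : ℕ) + k = n then 1 else c (i + 1)) ≤ B n (i + 1) ∧ B n (i + 1) ≤ c (i + 2) := by
      intro i hi
      rw [hrow i hi]
      have := (Finset.mem_filter.1 (hr i)).1
      rwa [interlaceRange, if_neg (by omega), Finset.mem_Icc] at this
    have hmp : ∀ i j, MagPos (n + 1) k i j → i ≠ n + 1 → MagPos n k i j := by
      unfold MagPos; intros; omega
    refine ⟨⟨fun i j hp => ?_, fun i j hp hp' => ?_, fun i j hp hp' => ?_, fun i j hp => ?_⟩,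
      fun j hj => ?_⟩
    · by_cases hi : i = n + 1
      · subst hi
        rw [addRow_last hp]
        unfold MagPos at hp
        exact ⟨hc.pos _ (by omega) (by omega), hc.le _ (by omega) (by omega)⟩
      · rw [addRow_of_ne hi]
        exact hB1 i j (hmp i j hp hi)
    · have hi : i ≠ n + 1 := by unfold MagPos at hp'; omega
      rw [addRow_of_ne hi]
      by_cases hi' : i = n
      · subst hi'
        rw [addRow_last hp']
        have hp2 := hp'
        unfold MagPos at hp hp2
        obtain ⟨j, rfl⟩ : ∃ t, j = t + 1 := ⟨j - 1, by omega⟩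
        have h := (hr' ⟨j, by omega⟩ (by simp only; omega)).1
        rwa [if_neg (by simp only; omega)] at h
      · rw [addRow_of_ne (by omega)]
        exact hB2 i j (hmp i j hp hi) (hmp _ _ hp' (by omega))
    · have hi : i ≠ n + 1 := by unfold MagPos at hp'; omega
      rw [addRow_of_ne hi]
      by_cases hi' : i = n
      · subst hi'
        rw [addRow_last hp']
        unfold MagPos at hp
        obtain ⟨j, rfl⟩ : ∃ t, j = t + 1 := ⟨j - 1, by omega⟩
        exact (hr' ⟨j, by omega⟩ (by simp only; omega)).2
      · rw [addRow_of_ne (by omega)]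
        exact hB3 i j (hmp i j hp hi) (hmp _ _ hp' (by omega))
    · by_cases hi : i = n + 1
      · subst hi
        simp [addRow, hp]
      · rw [addRow_of_ne hi]
        exact hB4 i j (by unfold MagPos at *; omega)
    · rw [Finset.mem_Icc] at hj
      exact addRow_last (by unfold MagPos; omega)

theorem injOn_addRow (m n k : ℕ) (c : ℕ → ℤ) :
    Set.InjOn (addRow n k c) {B | IsMagog m n k B} := by
  intro B hB B' hB' h
  funext i j
  by_cases hi : i = n + 1
  · have hp : ¬ MagPos n k i j := by unfold MagPos; omega
    rw [hB.2.2.2 i j hp, hB'.2.2.2 i j hp]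
  · have := congrFun (congrFun h i) j
    rwa [addRow_of_ne hi, addRow_of_ne hi] at this

theorem pairwiseDisjoint_magogSet (m n k : ℕ) (c : ℕ → ℤ) :
    (Fintype.piFinset (cappedRange m n k c) : Set (Fin n → ℤ)).PairwiseDisjoint
      fun r => magogSet m n k (extRow r) := by
  intro r hr r' hr' hne
  refine Set.disjoint_left.2 fun B hB hB' => hne ?_
  rw [Finset.mem_coe, Fintype.mem_piFinset] at hr hr'
  funext i
  by_cases hi : (i : ℕ) + k < n
  · have h1 := (Finset.mem_filter.1 (hr i)).1
    have h2 := (Finset.mem_filter.1 (hr' i)).1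
    rw [interlaceRange, if_pos hi, Finset.mem_singleton] at h1 h2
    rw [h1, h2]
  · have hmem : (i : ℕ) + 1 ∈ Finset.Icc (n - k + 1) n := Finset.mem_Icc.2 (by omega)
    have h1 := hB.2 _ hmem
    have h2 := hB'.2 _ hmem
    rw [extRow_succ] at h1 h2
    rw [← h1, h2]

theorem magMax_addRow (m n k : ℕ) (hk : 1 ≤ k) (c : ℕ → ℤ) (B : ℕ → ℕ → ℤ) :
    Pv ^ magMax m (n + 1) (addRow n k c B) =
      maxWeight m (n + 1) (c (n + 1)) * Pv ^ magMax m n B := by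
  have hp : MagPos (n + 1) k (n + 1) (n + 1) := by unfold MagPos; omega
  have h : (Finset.Icc 1 n).filter (fun i => addRow n k c B i i = (m : ℤ) + i) =
      (Finset.Icc 1 n).filter (fun i => B i i = (m : ℤ) + i) := by
    refine Finset.filter_congr fun i hi => ?_
    rw [Finset.mem_Icc] at hi
    rw [addRow_of_ne (by omega)]
  unfold magMax maxWeight
  rw [← Finset.insert_Icc_right_eq_Icc_add_one (by omega), Finset.filter_insert, h,
    addRow_last hp]
  split_ifs with h'
  · rw [Finset.card_insert_of_notMem (by simp), pow_succ']
  · rw [one_mul]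

theorem magMinAbove_addRow {m n k : ℕ} (hk : 1 ≤ k) (c : ℕ → ℤ) (r : Fin n → ℤ)
    {B : ℕ → ℕ → ℤ} (hB : B ∈ magogSet m n k (extRow r)) :
    Qv ^ magMinAbove (n + 1) k (addRow n k c B) =
      (∏ i : Fin n, minWeight n k i (r i)) * Qv ^ magMinAbove n k B := by
  have h : (Finset.Icc k (n + 1)).filter
        (fun i => i < n + 1 ∧ addRow n k c B i (i + 1 - k) = 1) =
      (Finset.Icc k n).filter (fun i => B i (i + 1 - k) = 1) := by
    ext i
    simp only [Finset.mem_filter, Finset.mem_Icc]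
    by_cases hi : i = n + 1
    · omega
    · rw [addRow_of_ne hi]
      omega
  have h' : (Finset.Icc k n).filter (fun i => i < n ∧ B i (i + 1 - k) = 1) =
      ((Finset.Icc k n).filter (fun i => B i (i + 1 - k) = 1)).erase n := by
    ext i
    simp only [Finset.mem_filter, Finset.mem_Icc, Finset.mem_erase]
    omega
  unfold magMinAbove
  rw [h, h']
  by_cases hkn : k ≤ n
  · have hn : n - k < n := by omega
    have hr : B n (n + 1 - k) = r ⟨n - k, hn⟩ := by
      rw [hB.2 _ (Finset.mem_Icc.2 (by omega)), show n + 1 - k = n - k + 1 by omega,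
        extRow_of_lt r _ hn]
    rw [Finset.prod_eq_single ⟨n - k, hn⟩]
    · unfold minWeight
      by_cases h1 : r ⟨n - k, hn⟩ = 1
      · have hmem : n ∈ (Finset.Icc k n).filter (fun i => B i (i + 1 - k) = 1) := by
          simp [hkn, hr, h1]
        rw [if_pos ⟨by simp only; omega, h1⟩, ← pow_succ', Finset.card_erase_add_one hmem]
      · rw [if_neg (by tauto), one_mul, Finset.erase_eq_of_notMem]
        simp [hr, h1]
    · intro i _ hi
      refine if_neg fun h2 => hi ?_
      ext
      simp only
      omega
    · simp
  · rw [Finset.Icc_eq_empty hkn, Finset.prod_eq_one]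
    · simp
    · intro i _
      exact if_neg (by omega)

theorem finsum_magogSet_eq_det (m k : ℕ) (hk : 1 ≤ k) (n : ℕ) (c : ℕ → ℤ)
    (hc : IsBottomRow m n k c) :
    (magogSet m n k c).Finite ∧
      ∑ᶠ B ∈ magogSet m n k c, Pv ^ magMax m n B * Qv ^ magMinAbove n k B =
        (magogMatrix m n k c).det := by
  induction n generalizing c with
  | zero =>
    rw [magogSet_zero, finsum_mem_singleton]
    refine ⟨Set.finite_singleton _, ?_⟩
    simp [magMax, magMinAbove]
  | succ n ih =>
    have ih' := fun r (hr : r ∈ (Fintype.piFinset (cappedRange m n k c) : Set (Fin n → ℤ))) =>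
      ih _ (isBottomRow_extRow hc hr)
    have hfin := Set.Finite.biUnion (Finset.finite_toSet _) fun r hr => (ih' r hr).1
    rw [magogSet_succ hc]
    refine ⟨hfin.image _, ?_⟩
    rw [finsum_mem_image ((injOn_addRow m n k c).mono
        (Set.iUnion₂_subset fun r _ B hB => hB.1)),
      finsum_mem_biUnion (pairwiseDisjoint_magogSet m n k c) (Finset.finite_toSet _)
        fun r hr => (ih' r hr).1,
      finsum_mem_coe_finset, det_magogMatrix_succ hk hc, Finset.mul_sum]
    refine Finset.sum_congr rfl fun r hr => ?_
    rw [← (ih' r hr).2, ← mul_assoc, mul_finsum_mem]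
    refine finsum_mem_congr rfl fun B hB => ?_
    rw [magMax_addRow m n k hk, magMinAbove_addRow hk c r hB]
    ring

/-- The generating function of `(m,n,k)`-Magog trapezoids with bottom row `(b_{n−k+1},…,b_n)`
w.r.t. `P^{#maxima} Q^{#minima not in the bottom row}` is the `n×n` determinant of
Lindström–Gessel–Viennot type described in the statement; an identity in `ℚ[P,Q]`. -/
theorem stmt12 (m n k : ℕ) (hk : 1 ≤ k) (hkn : k ≤ n) (b : ℕ → ℤ)
    (hb1 : 1 ≤ b (n - k + 1)) (hbw : ∀ i, n - k + 1 ≤ i → i < n → b i ≤ b (i+1))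
    (hbu : ∀ i, n - k + 1 ≤ i → i ≤ n → b i ≤ (m : ℤ) + i) :
    (∑ᶠ B ∈ {B : ℕ → ℕ → ℤ | IsMagog m n k B ∧ ∀ j ∈ Finset.Icc (n - k + 1) n, B n j = b j},
        Pv ^ magMax m n B * Qv ^ magMinAbove n k B) =
    Matrix.det (Matrix.of fun i0 j0 : Fin n =>
      if (i0 : ℕ) + 1 ≤ n - k then
        MvPolynomial.C (qchoose ((j0 : ℤ) + 1 + k + m - 3) (2 * ((j0 : ℤ) + 1) + m - ((i0 : ℤ) + 1) - 3)) +
          (Pv + Qv) *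
            MvPolynomial.C (qchoose ((j0 : ℤ) + 1 + k + m - 3) (2 * ((j0 : ℤ) + 1) + m - ((i0 : ℤ) + 1) - 2)) +
          Pv * Qv *
            MvPolynomial.C (qchoose ((j0 : ℤ) + 1 + k + m - 3) (2 * ((j0 : ℤ) + 1) + m - ((i0 : ℤ) + 1) - 1))
      else
        MvPolynomial.C (qchoose ((j0 : ℤ) + 1 + m + n - b ((i0 : ℕ) + 1) - ((i0 : ℤ) + 1) - 1)
            (2 * ((j0 : ℤ) + 1) + m - b ((i0 : ℕ) + 1) - ((i0 : ℤ) + 1) - 1)) +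
          Pv * MvPolynomial.C (qchoose ((j0 : ℤ) + 1 + m + n - b ((i0 : ℕ) + 1) - ((i0 : ℤ) + 1) - 1)
            (2 * ((j0 : ℤ) + 1) + m - b ((i0 : ℕ) + 1) - ((i0 : ℤ) + 1)))) := by
  have hmono : ∀ d, n - k + 1 + d ≤ n → 1 ≤ b (n - k + 1 + d) := by
    intro d
    induction d with
    | zero => exact fun _ => hb1
    | succ d ih =>
      exact fun h => (ih (by omega)).trans (hbw (n - k + 1 + d) (by omega) (by omega))
  have hc : IsBottomRow m n k b := by
    refine ⟨fun i hi hin => ?_, hbw, hbu⟩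
    have := hmono (i - (n - k + 1)) (by omega)
    rwa [Nat.add_sub_cancel' hi] at this
  refine (finsum_magogSet_eq_det m k hk n b hc).2.trans ?_
  rfl
end

section
/- Let r ≥ 1 be an integer. In the field of rational functions ℚ(y_1,…,y_r), Σ_{σ∈S_r} sgn(σ) · ∏_{i=1}^{r} y_{σ(i)}^{i−1}/(1 − ∏_{j=i}^{r} y_{σ(j)}) = ∏_{i=1}^{r} (1−y_i)^{−1} · ∏_{1≤i<j≤r} (y_j − y_i)/(1 − y_i y_j), where S_r is the symmetric group on {1,…,r} and σ acts by permuting the variables y_1,…,y_r. -/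
open scoped BigOperators

/-- The field of rational functions `ℚ(y_1, …, y_r)`. -/
noncomputable abbrev RatFunF (r : ℕ) : Type := FractionRing (MvPolynomial (Fin r) ℚ)

/-- The variable `y_i` viewed inside the rational function field. -/
noncomputable def yv {r : ℕ} (i : Fin r) : RatFunF r :=
  algebraMap (MvPolynomial (Fin r) ℚ) (RatFunF r) (MvPolynomial.X i)

/-- A partial fraction identity, obtained by Lagrange interpolation of `∏ j, (1 + y j * X)` at the
nodes `0`, `1` and `-y j`. -/
theorem sum_mul_prod_erase_div_sub {ι K : Type*} [Fintype ι] [DecidableEq ι] [Field K] (y : ι → K)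
    (hy : Function.Injective y) (h0 : ∀ i, y i ≠ 0) (h1 : ∀ i, y i ≠ -1) :
    ∑ k, (1 - y k) * ∏ j ∈ Finset.univ.erase k, y j * ((1 - y k * y j) / (y j - y k)) =
      1 - ∏ j, y j := by
  let v : Option (Option ι) → K := fun o => o.elim 0 (fun o => o.elim 1 (fun i => -y i))
  have hv : Set.InjOn v ((Finset.univ : Finset (Option (Option ι))) : Set (Option (Option ι))) := by
    rintro (_ | _ | i) - (_ | _ | j) - h <;> simp [v] at h ⊢
    · exact h0 _ h
    · exact h1 _ (by rw [h, neg_neg])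
    · exact h0 _ h
    · exact h1 _ (by rw [← h, neg_neg])
    · exact hy h
  let P : Polynomial K := ∏ j, (1 + Polynomial.C (y j) * Polynomial.X)
  have hP : P.natDegree ≤ Fintype.card ι := by
    refine (Polynomial.natDegree_prod_le _ _).trans ?_
    refine (Finset.sum_le_card_nsmul _ _ 1 fun j _ => ?_).trans (by simp)
    compute_degree
  have hcard : (Finset.univ : Finset (Option (Option ι))).card = Fintype.card ι + 2 := by
    simp
  have key := Lagrange.coeff_eq_sum hv (P := P)
    (Polynomial.degree_le_natDegree.trans_lt (by rw [hcard]; exact_mod_cast by omega))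
  rw [hcard, Polynomial.coeff_eq_zero_of_natDegree_lt (by omega)] at key
  have herase : ∀ (o : Option (Option ι)) (f : Option (Option ι) → K),
      ∏ j ∈ Finset.univ.erase o, f j = ∏ j, if j = o then 1 else f j := by
    intro o f
    rw [← Finset.mul_prod_erase Finset.univ _ (Finset.mem_univ o), if_pos rfl, one_mul]
    exact Finset.prod_congr rfl fun j hj => (if_neg (Finset.ne_of_mem_erase hj)).symm
  have heval : ∀ x, P.eval x = ∏ j, (1 + y j * x) := by
    intro x; simp [P, Polynomial.eval_prod]
  simp only [herase, Fintype.sum_option, Fintype.prod_option, heval] at key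
  have hY : ∏ j, y j ≠ 0 := Finset.prod_ne_zero_iff.mpr fun i _ => h0 i
  have hY1 : ∏ j, (1 + y j) ≠ 0 := Finset.prod_ne_zero_iff.mpr fun i _ h =>
    h1 i (eq_neg_of_add_eq_zero_right h)
  replace key : 0 = -(∏ j, y j)⁻¹ + (1 + ∑ k, (∏ j, (1 + -(y j * y k))) /
      -(y k * ((-y k - 1) * ∏ j, if j = k then 1 else -y k + y j))) := by
    simpa [v, hY1] using key
  have hterm : ∀ k, (1 - y k) * ∏ j ∈ Finset.univ.erase k, y j * ((1 - y k * y j) / (y j - y k)) =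
      (∏ j, y j) * ((∏ j, (1 + -(y j * y k))) /
        (-(y k * ((-y k - 1) * ∏ j, if j = k then 1 else -y k + y j)))) := by
    intro k
    have e1 : ∏ j, (if j = k then 1 else -y k + y j) =
        ∏ j ∈ Finset.univ.erase k, (y j - y k) := by
      rw [← Finset.mul_prod_erase Finset.univ _ (Finset.mem_univ k), if_pos rfl, one_mul]
      refine Finset.prod_congr rfl fun j hj => ?_
      rw [if_neg (Finset.ne_of_mem_erase hj)]; ring
    have e2 : ∏ j ∈ Finset.univ.erase k, (1 + -(y j * y k)) =
        ∏ j ∈ Finset.univ.erase k, (1 - y k * y j) :=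
      Finset.prod_congr rfl fun j _ => by ring
    have hne : ∏ j ∈ Finset.univ.erase k, (y j - y k) ≠ 0 :=
      Finset.prod_ne_zero_iff.mpr fun j hj => sub_ne_zero.mpr
        (hy.ne (Finset.ne_of_mem_erase hj))
    have hk1 : y k + 1 ≠ 0 := fun h => h1 k (eq_neg_of_add_eq_zero_left h)
    have hk2 : -y k - 1 ≠ 0 := fun h => hk1 (by linear_combination -h)
    have hk0 := h0 k
    rw [e1, ← Finset.mul_prod_erase Finset.univ y (Finset.mem_univ k),
      ← Finset.mul_prod_erase Finset.univ (fun j => 1 + -(y j * y k)) (Finset.mem_univ k), e2,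
      Finset.prod_mul_distrib, Finset.prod_div_distrib]
    field_simp
    ring
  rw [Finset.sum_congr rfl fun k _ => hterm k, ← Finset.mul_sum]
  linear_combination (-∏ j, y j) * key + mul_inv_cancel₀ hY

/-- The number of `i` such that `k.succAbove i < k` is `k`, in the form of a product of signs. -/
theorem Fin.prod_ite_succAbove_lt {n : ℕ} {R : Type*} [CommRing R] (k : Fin (n + 1)) :
    ∏ i : Fin n, (if k.succAbove i < k then (-1 : R) else 1) = (-1) ^ (k : ℕ) := by
  rw [Finset.prod_ite, Finset.prod_const_one, mul_one, Finset.prod_const]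
  simp only [Fin.succAbove_lt_iff_castSucc_lt]
  congr 1
  have : (Finset.univ.filter fun i : Fin n => i.castSucc < k) =
      Finset.univ.filter fun i : Fin n => (i : ℕ) < k := by
    ext; simp [Fin.lt_def]
  rw [this, Fin.card_filter_val_lt]
  exact min_eq_right (Nat.lt_succ_iff.mp k.isLt)

/-- Splitting off one index from a product over increasing pairs of an antisymmetric function. -/
theorem Fin.prod_lt_succAbove {n : ℕ} {R : Type*} [CommRing R] (f : Fin (n + 1) → Fin (n + 1) → R)
    (hf : ∀ i j, f i j = -f j i) (k : Fin (n + 1)) :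
    ∏ p ∈ Finset.univ.filter (fun p : Fin (n + 1) × Fin (n + 1) => p.1 < p.2), f p.1 p.2 =
      (-1) ^ (k : ℕ) * (∏ i, f k (k.succAbove i)) *
        ∏ p ∈ Finset.univ.filter (fun p : Fin n × Fin n => p.1 < p.2),
          f (k.succAbove p.1) (k.succAbove p.2) := by
  simp only [Finset.prod_filter, Fintype.prod_prod_type]
  rw [Fin.prod_univ_succAbove _ k, Fin.prod_univ_succAbove _ k]
  simp only [Fin.prod_univ_succAbove _ k, lt_irrefl, if_false, one_mul, Finset.prod_mul_distrib,
    Fin.succAbove_lt_succAbove_iff, ← Fin.prod_ite_succAbove_lt (R := R) k]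
  rw [← mul_assoc]
  congr 1
  rw [← Finset.prod_mul_distrib, ← Finset.prod_mul_distrib]
  refine Finset.prod_congr rfl fun i _ => ?_
  rcases lt_or_gt_of_ne (Fin.succAbove_ne k i) with h | h
  · simp [h, h.not_gt, hf k]
  · simp [h, h.not_gt]

/-- The expansion of a signed sum over permutations along the value at `0`. -/
theorem Equiv.Perm.sum_sign_mul_succ {n : ℕ} {R α : Type*} [CommRing R]
    (F : (Fin (n + 1) → α) → R) (y : Fin (n + 1) → α) :
    ∑ σ : Equiv.Perm (Fin (n + 1)), ((Equiv.Perm.sign σ : ℤ) : R) * F (y ∘ σ) =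
      ∑ k : Fin (n + 1), (-1) ^ (k : ℕ) * ∑ σ : Equiv.Perm (Fin n),
        ((Equiv.Perm.sign σ : ℤ) : R) * F (Fin.cons (y k) (y ∘ k.succAbove ∘ σ)) := by
  rw [Finset.univ_perm_fin_succ, Finset.sum_map, ← Finset.univ_product_univ, Finset.sum_product]
  refine Finset.sum_congr rfl fun k _ => ?_
  simp only [Equiv.toEmbedding_apply, Equiv.Perm.decomposeFin.symm_sign]
  have hcomp : ∀ σ : Equiv.Perm (Fin n), y ∘ Equiv.Perm.decomposeFin.symm (k, σ) =
      Fin.cons (y k) fun j => y (Equiv.swap 0 k (σ j).succ) := by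
    intro σ
    ext j
    refine Fin.cases ?_ (fun j => ?_) j <;> simp
  simp only [hcomp]
  refine Fin.cases ?_ (fun k => ?_) k
  · simp [Function.comp_def]
  · rw [← Equiv.sum_comp (Equiv.mulLeft k.cycleRange⁻¹), Finset.mul_sum]
    refine Finset.sum_congr rfl fun σ _ => ?_
    simp [Function.comp_def, Fin.sign_cycleRange, pow_succ]
    simp only [← Fin.succAbove_cycleRange, Equiv.apply_symm_apply]
    ring

/-- The identity for elements of a field in general position. -/
theorem sum_sign_mul_prod_div_one_sub_prod {K : Type*} [Field K] (n : ℕ) (y : Fin n → K)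
    (hy : Function.Injective y) (h0 : ∀ i, y i ≠ 0) (h1 : ∀ i, y i ≠ -1)
    (hprod : ∀ s : Finset (Fin n), s.Nonempty → ∏ i ∈ s, y i ≠ 1) :
    (∑ σ : Equiv.Perm (Fin n), ((Equiv.Perm.sign σ : ℤ) : K) *
      ∏ i : Fin n, (y (σ i)) ^ (i : ℕ) /
          (1 - ∏ j ∈ Finset.univ.filter (fun j : Fin n => i ≤ j), y (σ j))) =
    (∏ i : Fin n, (1 - y i)⁻¹) *
      ∏ p ∈ Finset.univ.filter (fun p : Fin n × Fin n => p.1 < p.2),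
        (y p.2 - y p.1) / (1 - y p.1 * y p.2) := by
  induction n with
  | zero => simp
  | succ n ih =>
    have hmul : ∀ i j, i ≠ j → 1 - y i * y j ≠ 0 := fun i j hij h =>
      hprod {i, j} (by simp) (by rw [Finset.prod_pair hij]; linear_combination -h)
    have hone : ∀ i, 1 - y i ≠ 0 := fun i h =>
      hprod {i} (by simp) (by rw [Finset.prod_singleton]; linear_combination -h)
    have hall : 1 - ∏ j, y j ≠ 0 := fun h =>
      hprod Finset.univ Finset.univ_nonempty (by linear_combination -h)
    have hexp := Equiv.Perm.sum_sign_mul_succ (fun z : Fin (n + 1) → K => ∏ i : Fin (n + 1),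
      (z i) ^ (i : ℕ) / (1 - ∏ j ∈ Finset.univ.filter (fun j : Fin (n + 1) => i ≤ j), z j)) y
    simp only [Function.comp_apply] at hexp
    rw [hexp]
    have hF : ∀ (k : Fin (n + 1)) (σ : Equiv.Perm (Fin n)),
        (∏ i : Fin (n + 1), (Fin.cons (y k) (y ∘ k.succAbove ∘ σ) : Fin (n + 1) → K) i ^ (i : ℕ) /
          (1 - ∏ j ∈ Finset.univ.filter (fun j : Fin (n + 1) => i ≤ j),
            (Fin.cons (y k) (y ∘ k.succAbove ∘ σ) : Fin (n + 1) → K) j)) =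
        (1 - ∏ j, y j)⁻¹ * (∏ i, y (k.succAbove i)) *
          ∏ i : Fin n, (y (k.succAbove (σ i))) ^ (i : ℕ) /
            (1 - ∏ j ∈ Finset.univ.filter (fun j : Fin n => i ≤ j), y (k.succAbove (σ j))) := by
      intro k σ
      rw [← Equiv.prod_comp σ (fun i => y (k.succAbove i)), mul_assoc, ← Finset.prod_mul_distrib]
      rw [Fin.prod_univ_succ]
      congr 1
      · rw [Fin.prod_univ_succAbove y k, ← Equiv.prod_comp σ (fun i => y (k.succAbove i))]
        simp [Fin.prod_univ_succ]
      · refine Finset.prod_congr rfl fun i _ => ?_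
        simp [Finset.prod_filter, Fin.prod_univ_succ, pow_succ]
        ring
    have hstep : ∀ k : Fin (n + 1), ∑ σ : Equiv.Perm (Fin n), ((Equiv.Perm.sign σ : ℤ) : K) *
          ∏ i : Fin n, (y (k.succAbove (σ i))) ^ (i : ℕ) /
            (1 - ∏ j ∈ Finset.univ.filter (fun j : Fin n => i ≤ j), y (k.succAbove (σ j))) =
        (∏ i : Fin n, (1 - y (k.succAbove i))⁻¹) *
          ∏ p ∈ Finset.univ.filter (fun p : Fin n × Fin n => p.1 < p.2),
            (y (k.succAbove p.2) - y (k.succAbove p.1)) /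
              (1 - y (k.succAbove p.1) * y (k.succAbove p.2)) := fun k =>
      ih (fun i => y (k.succAbove i)) (hy.comp Fin.succAbove_right_injective)
        (fun i => h0 _) (fun i => h1 _) fun s hs => by
          have := hprod (s.map k.succAboveEmb) (by simpa using hs)
          simpa using this
    have hlag := sum_mul_prod_erase_div_sub y hy h0 h1
    rw [← inv_mul_cancel_left₀ hall (_ * ∏ p ∈ _, _), ← mul_assoc]
    conv_rhs => enter [1, 2]; rw [← hlag]
    rw [Finset.mul_sum, Finset.sum_mul]
    refine Finset.sum_congr rfl fun k _ => ?_
    simp only [hF, mul_left_comm _ ((1 - ∏ j, y j)⁻¹ * (∏ i, y (k.succAbove i)))]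
    rw [← Finset.mul_sum, hstep, Fin.prod_univ_succAbove (fun i => (1 - y i)⁻¹) k,
      Fin.prod_lt_succAbove (fun i j => (y j - y i) / (1 - y i * y j))
        (fun i j => by rw [mul_comm (y j), ← neg_div, neg_sub]) k]
    have herase : ∏ j ∈ Finset.univ.erase k, y j * ((1 - y k * y j) / (y j - y k)) =
        ∏ i : Fin n, y (k.succAbove i) *
          ((1 - y k * y (k.succAbove i)) / (y (k.succAbove i) - y k)) := by
      rw [← Finset.compl_singleton, ← Fin.image_succAbove_univ,
        Finset.prod_image (Fin.succAbove_right_injective.injOn)]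
    have hcancel : (∏ i : Fin n, (1 - y k * y (k.succAbove i)) / (y (k.succAbove i) - y k)) *
        ∏ i : Fin n, (y (k.succAbove i) - y k) / (1 - y k * y (k.succAbove i)) = 1 := by
      rw [← Finset.prod_mul_distrib]
      refine Finset.prod_eq_one fun i _ => ?_
      have := hmul k (k.succAbove i) (Fin.succAbove_ne k i).symm
      have : y (k.succAbove i) - y k ≠ 0 := sub_ne_zero.mpr (hy.ne (Fin.succAbove_ne k i))
      field_simp
    rw [herase, Finset.prod_mul_distrib]
    have hk := mul_inv_cancel₀ (hone k)
    generalize (∏ i : Fin n, (1 - y k * y (k.succAbove i)) / (y (k.succAbove i) - y k)) = B at *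
    generalize (∏ i : Fin n, (y (k.succAbove i) - y k) / (1 - y k * y (k.succAbove i))) = C at *
    linear_combination (-(-1) ^ (k : ℕ) * (1 - ∏ j, y j)⁻¹ * (∏ i, y (k.succAbove i)) *
      (∏ i, (1 - y (k.succAbove i))⁻¹) *
      ∏ p ∈ Finset.univ.filter (fun p : Fin n × Fin n => p.1 < p.2),
        (y (k.succAbove p.2) - y (k.succAbove p.1)) /
          (1 - y (k.succAbove p.1) * y (k.succAbove p.2))) * ((B * C) * hk + hcancel)

/-- Lemma (Zeilberger/Macdonald):
`Σ_{σ∈S_r} sgn σ · ∏_{i=1}^r y_{σ(i)}^{i−1}/(1 − ∏_{j=i}^r y_{σ(j)})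
  = ∏_{i=1}^r (1−y_i)^{−1} ∏_{1≤i<j≤r} (y_j − y_i)/(1 − y_i y_j)`. -/
theorem stmt16 (r : ℕ) (hr : 1 ≤ r) :
    (∑ σ : Equiv.Perm (Fin r), ((Equiv.Perm.sign σ : ℤ) : RatFunF r) *
      ∏ i : Fin r,
        (yv (σ i)) ^ (i : ℕ) /
          (1 - ∏ j ∈ Finset.univ.filter (fun j : Fin r => i ≤ j), yv (σ j))) =
    (∏ i : Fin r, (1 - yv i)⁻¹) *
      ∏ p ∈ Finset.univ.filter (fun p : Fin r × Fin r => p.1 < p.2),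
        (yv p.2 - yv p.1) / (1 - yv p.1 * yv p.2) := by
  have hinj : Function.Injective (algebraMap (MvPolynomial (Fin r) ℚ) (RatFunF r)) :=
    IsFractionRing.injective _ _
  refine sum_sign_mul_prod_div_one_sub_prod r yv (hinj.comp (MvPolynomial.X_injective)) ?_ ?_ ?_
  · intro i h
    exact MvPolynomial.X_ne_zero i (hinj (h.trans (map_zero _).symm))
  · intro i h
    have h' : (MvPolynomial.X i : MvPolynomial (Fin r) ℚ) = -1 := hinj (by simpa [yv] using h)
    simpa using congrArg MvPolynomial.constantCoeff h'
  · intro s hs h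
    have h' : ∏ i ∈ s, (MvPolynomial.X i : MvPolynomial (Fin r) ℚ) = 1 :=
      hinj (by simpa [yv] using h)
    have h'' := congrArg MvPolynomial.constantCoeff h'
    simp [map_prod, hs.card_ne_zero] at h''
end
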